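/- Let G be a connected swm-graph. Let G* (the barycentric graph of G) be the graph whose vertices are the Boolean-gated sets of G of finite diameter, two such sets X,Y being adjacent if and only if one of them properly contains the other and no Boolean-gated set of finite diameter lies strictly between them. Then: (a) G* is a modular graph; (b) the orientation of G* directing each edge XY with X ⊊ Y from Y to X is admissible; (c) the map p ↦ {p} embeds G isometrically into G* up to scale two, i.e. d_{G*}({p},{q}) = 2·d_G(p,q) for all vertices p,q of G. -/

import Mathlib

variable {V : Type*}

/-- Triangle condition (TC). -/
def TriangleCondition (G : SimpleGraph V) : Prop :=
  ∀ u v w : V, G.Adj v w → G.dist u v = G.dist u w → 1 ≤ G.dist u v →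
    ∃ x : V, G.Adj v x ∧ G.Adj w x ∧ G.dist u x + 1 = G.dist u v

/-- Quadrangle condition (QC). -/
def QuadrangleCondition (G : SimpleGraph V) : Prop :=
  ∀ u v w z : V, G.Adj z v → G.Adj z w → G.dist v w = 2 →
    G.dist u v = G.dist u w → G.dist u z = G.dist u v + 1 →
    ∃ x : V, G.Adj v x ∧ G.Adj w x ∧ G.dist u x + 1 = G.dist u v

def WeaklyModular (G : SimpleGraph V) : Prop :=
  TriangleCondition G ∧ QuadrangleCondition G

/-- The metric interval `I(u,v)`. -/
def gInterval (G : SimpleGraph V) (u v : V) : Set V :=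
  {x : V | G.dist u x + G.dist x v = G.dist u v}

/-- `G` contains an induced `K₄` minus an edge. -/
def HasInducedK4minus (G : SimpleGraph V) : Prop :=
  ∃ a b c d : V, G.Adj a b ∧ G.Adj a c ∧ G.Adj a d ∧ G.Adj b c ∧ G.Adj b d ∧
    c ≠ d ∧ ¬ G.Adj c d

/-- `G` contains an isometric `K₃,₃` minus an edge. -/
def HasIsometricK33minus (G : SimpleGraph V) : Prop :=
  ∃ a₁ a₂ a₃ b₁ b₂ b₃ : V,
    G.Adj a₁ b₁ ∧ G.Adj a₁ b₂ ∧ G.Adj a₁ b₃ ∧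
    G.Adj a₂ b₁ ∧ G.Adj a₂ b₂ ∧ G.Adj a₂ b₃ ∧
    G.Adj a₃ b₁ ∧ G.Adj a₃ b₂ ∧
    G.dist a₁ a₂ = 2 ∧ G.dist a₁ a₃ = 2 ∧ G.dist a₂ a₃ = 2 ∧
    G.dist b₁ b₂ = 2 ∧ G.dist b₁ b₃ = 2 ∧ G.dist b₂ b₃ = 2 ∧
    G.dist a₃ b₃ = 3

/-- Induced 4-cycle `(a,b,c,d)`. -/
def InducedSquare (G : SimpleGraph V) (a b c d : V) : Prop :=
  G.Adj a b ∧ G.Adj b c ∧ G.Adj c d ∧ G.Adj d a ∧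
    a ≠ c ∧ b ≠ d ∧ ¬ G.Adj a c ∧ ¬ G.Adj b d

/-- A graph is thick if every interval between vertices at distance 2 contains
four vertices inducing a 4-cycle. -/
def Thick (G : SimpleGraph V) : Prop :=
  ∀ u v : V, G.dist u v = 2 →
    ∃ a b c d : V, a ∈ gInterval G u v ∧ b ∈ gInterval G u v ∧
      c ∈ gInterval G u v ∧ d ∈ gInterval G u v ∧ InducedSquare G a b c d

/-- A set of vertices is gated if every vertex has a gate in it. -/
def Gated (G : SimpleGraph V) (A : Set V) : Prop :=
  ∀ x : V, ∃ g ∈ A, ∀ y ∈ A, G.dist x y = G.dist x g + G.dist g y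

/-- Boolean-gated set: a gated set whose induced subgraph is thick. -/
def BooleanGated (G : SimpleGraph V) (A : Set V) : Prop :=
  Gated G A ∧ Thick (G.induce A)

/-- Boolean-gated sets of finite diameter of `G`. -/
abbrev BSet (G : SimpleGraph V) :=
  {A : Set V // BooleanGated G A ∧ ∃ D : ℕ, ∀ x ∈ A, ∀ y ∈ A, G.dist x y ≤ D}

/-- The barycentric graph `G*`: Boolean-gated sets of finite diameter, two of them
adjacent iff one properly contains the other with no such set strictly in between. -/
def barycentric (G : SimpleGraph V) : SimpleGraph (BSet G) :=
  SimpleGraph.fromRel fun X Y =>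
    X.1 ⊂ Y.1 ∧ ¬ ∃ Z : BSet G, X.1 ⊂ Z.1 ∧ Z.1 ⊂ Y.1

/-- A modular graph: connected and every triple of vertices has a median. -/
def IsModularGraph {W : Type*} (H : SimpleGraph W) : Prop :=
  H.Connected ∧ ∀ u v w : W, ∃ m : W,
    m ∈ gInterval H u v ∧ m ∈ gInterval H v w ∧ m ∈ gInterval H w u

/-- Connected swm-graphs, with their defining properties bundled. -/
structure IsSWM (G : SimpleGraph V) : Prop where
  conn : G.Connected
  wm : WeaklyModular G
  k4 : ¬ HasInducedK4minus G
  k33 : ¬ HasIsometricK33minus G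

namespace IsSWM

variable {G : SimpleGraph V}

theorem dcomm (G : SimpleGraph V) (a b : V) : G.dist a b = G.dist b a :=
  SimpleGraph.dist_comm

theorem tri (h : IsSWM G) (a b c : V) : G.dist a c ≤ G.dist a b + G.dist b c :=
  h.conn.dist_triangle

theorem eq_of_dist (h : IsSWM G) {a b : V} (e : G.dist a b = 0) : a = b :=
  h.conn.dist_eq_zero_iff.1 e

theorem adj_of_dist {a b : V} (e : G.dist a b = 1) : G.Adj a b :=
  SimpleGraph.dist_eq_one_iff_adj.1 e

theorem dist_of_adj {a b : V} (e : G.Adj a b) : G.dist a b = 1 :=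
  SimpleGraph.dist_eq_one_iff_adj.2 e

theorem adj_le (h : IsSWM G) {v w : V} (e : G.Adj v w) (u : V) :
    G.dist u v ≤ G.dist u w + 1 ∧ G.dist u w ≤ G.dist u v + 1 := by
  have := h.tri u v w
  have := h.tri u w v
  have := dist_of_adj e
  have := dist_of_adj e.symm
  omega

/-- Two distinct vertices with a common neighbour are adjacent or at distance two. -/
theorem adj_or_two (h : IsSWM G) {a b c : V} (e : G.Adj a b) (f : G.Adj b c) (hne : a ≠ c) :
    G.Adj a c ∨ G.dist a c = 2 := by
  have := h.tri a b c
  have := dist_of_adj e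
  have := dist_of_adj f
  have h0 : G.dist a c ≠ 0 := fun h0 => hne (h.eq_of_dist h0)
  by_cases h1 : G.dist a c = 1
  · exact Or.inl (adj_of_dist h1)
  · omega

theorem exists_toward (h : IsSWM G) {x z : V} (hne : x ≠ z) :
    ∃ v, G.Adj v z ∧ G.dist x v + 1 = G.dist x z := by
  obtain ⟨p, hp⟩ := h.conn.exists_walk_length_eq_dist z x
  cases p with
  | nil => exact absurd rfl hne
  | @cons _ v _ e q =>
    refine ⟨v, e.symm, ?_⟩
    have := SimpleGraph.dist_le q
    have := h.adj_le e x
    simp only [SimpleGraph.Walk.length_cons] at hp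
    rw [dcomm G z x] at hp
    rw [dcomm G v x] at *
    omega

theorem exists_mid (h : IsSWM G) {a c : V} (e : G.dist a c = 2) :
    ∃ b, G.Adj a b ∧ G.Adj b c := by
  have hne : a ≠ c := by rintro rfl; simp at e
  obtain ⟨v, hv, hd⟩ := h.exists_toward hne
  exact ⟨v, adj_of_dist (by omega), hv⟩

theorem exists_toward_mid (h : IsSWM G) {x w z : V} (hne : w ≠ z)
    (hw : G.dist x w + G.dist w z = G.dist x z) :
    ∃ v, G.Adj v z ∧ G.dist x v + 1 = G.dist x z ∧ G.dist w v + 1 = G.dist w z ∧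
      G.dist x w + G.dist w v = G.dist x v := by
  obtain ⟨v, hv, hd⟩ := h.exists_toward hne
  have := h.tri x w v
  have := h.adj_le hv x
  exact ⟨v, hv, by omega, hd, by omega⟩

theorem K4 (h : IsSWM G) {a b c e : V} (hab : G.Adj a b) (hca : G.Adj c a) (hcb : G.Adj c b)
    (hea : G.Adj e a) (heb : G.Adj e b) : c = e ∨ G.Adj c e := by
  by_contra! hne
  exact h.k4 ⟨a, b, c, e, hab, hca.symm, hea.symm, hcb.symm, heb.symm, hne.1, hne.2⟩

theorem TC (h : IsSWM G) {u v w : V} (e : G.Adj v w) (hd : G.dist u v = G.dist u w) :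
    ∃ x, G.Adj v x ∧ G.Adj w x ∧ G.dist u x + 1 = G.dist u v := by
  refine h.wm.1 u v w e hd ?_
  by_contra h0
  have h1 := h.eq_of_dist (show G.dist u v = 0 by omega)
  have h2 := h.eq_of_dist (show G.dist u w = 0 by omega)
  exact e.ne (h1.symm.trans h2)

theorem not_adj_of_farther (h : IsSWM G) {u v w z : V} (hv : G.Adj z v) (hw : G.Adj z w)
    (hd : G.dist u v = G.dist u w) (hz : G.dist u z = G.dist u v + 1) : ¬ G.Adj v w := by
  intro e
  obtain ⟨x, hx, hx', hxd⟩ := h.TC e hd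
  have : z ≠ x := by rintro rfl; omega
  have h1 := (h.K4 e hv hw hx.symm hx'.symm).resolve_left this
  have := h.adj_le h1 u
  omega

theorem QC (h : IsSWM G) {u v w z : V} (hv : G.Adj z v) (hw : G.Adj z w) (hne : v ≠ w)
    (hd : G.dist u v = G.dist u w) (hz : G.dist u z = G.dist u v + 1) :
    G.dist v w = 2 ∧ ∃ x, G.Adj v x ∧ G.Adj w x ∧ G.dist u x + 1 = G.dist u v := by
  have h2 : G.dist v w = 2 :=
    (h.adj_or_two hv.symm hw hne).resolve_left (h.not_adj_of_farther hv hw hd hz)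
  exact ⟨h2, h.wm.2 u v w z hv hw h2 hd hz⟩

/-! ### Gated sets -/

/-- `g` is the gate of `x` in `A`. -/
def IsGate (G : SimpleGraph V) (A : Set V) (x g : V) : Prop :=
  g ∈ A ∧ ∀ y ∈ A, G.dist x y = G.dist x g + G.dist g y

theorem IsGate.unique (h : IsSWM G) {A : Set V} {x g g' : V} (hg : IsGate G A x g)
    (hg' : IsGate G A x g') : g = g' := by
  have h1 := hg.2 g' hg'.1
  have h2 := hg'.2 g hg.1
  have := h.eq_of_dist (show G.dist g g' = 0 by omega)
  exact this

theorem isGate_self {A : Set V} {x : V} (hx : x ∈ A) : IsGate G A x x :=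
  ⟨hx, fun y _ => by simp⟩

theorem gated_convex (h : IsSWM G) {A : Set V} (hA : Gated G A) {x y z : V} (hx : x ∈ A)
    (hy : y ∈ A) (hz : G.dist x z + G.dist z y = G.dist x y) : z ∈ A := by
  obtain ⟨g, hg, hg'⟩ := hA z
  have h1 := hg' x hx
  have h2 := hg' y hy
  have h3 := h.tri x g y
  rw [dcomm G z x, dcomm G g x] at h1
  have := h.eq_of_dist (show G.dist z g = 0 by omega)
  exact this ▸ hg

theorem gated_two (h : IsSWM G) {A : Set V} (hA : Gated G A) {v a b : V} (ha : a ∈ A)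
    (hb : b ∈ A) (hne : a ≠ b) (hva : G.Adj v a) (hvb : G.Adj v b) : v ∈ A := by
  obtain ⟨g, hg, hg'⟩ := hA v
  have h1 := hg' a ha
  have h2 := hg' b hb
  rw [dist_of_adj hva] at h1
  rw [dist_of_adj hvb] at h2
  by_cases h0 : G.dist v g = 0
  · exact h.eq_of_dist h0 ▸ hg
  · exact absurd ((h.eq_of_dist (show G.dist g a = 0 by omega)).symm.trans
      (h.eq_of_dist (show G.dist g b = 0 by omega))) hne

/-- A set that is star-shaped around one of its vertices and closed under vertices with two
neighbours in the set is gated. -/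
theorem gated_of_star (h : IsSWM G) {A : Set V} {x : V} (hx : x ∈ A)
    (star : ∀ z ∈ A, ∀ w, G.dist x w + G.dist w z = G.dist x z → w ∈ A)
    (two : ∀ v a b, a ∈ A → b ∈ A → a ≠ b → G.Adj v a → G.Adj v b → v ∈ A) : Gated G A := by
  intro p
  let r : A → A → Prop := fun y z => G.Adj y.1 z.1 ∧ G.dist p z.1 + 1 = G.dist p y.1
  have eqv : Equivalence (Relation.Join (Relation.ReflTransGen r)) := by
    refine Relation.equivalence_join_reflTransGen ?_
    rintro ⟨a, ha⟩ ⟨b, hb⟩ ⟨c, hc⟩ ⟨hab, hab'⟩ ⟨hac, hac'⟩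
    by_cases hbc : b = c
    · subst hbc
      exact ⟨⟨b, hb⟩, Relation.ReflGen.refl, Relation.ReflTransGen.refl⟩
    · simp only at hab hab' hac hac'
      obtain ⟨-, e, he, he', hed⟩ := h.QC hab hac hbc (u := p) (by omega) (by omega)
      have heA : e ∈ A := two e b c hb hc hbc he.symm he'.symm
      exact ⟨⟨e, heA⟩, Relation.ReflGen.single ⟨he, hed⟩,
        Relation.ReflTransGen.single ⟨he', by simp only; omega⟩⟩
  have single : ∀ a b : A, r a b → Relation.Join (Relation.ReflTransGen r) a b :=
    fun a b hab => ⟨b, Relation.ReflTransGen.single hab, Relation.ReflTransGen.refl⟩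
  have adj : ∀ a b : A, G.Adj a.1 b.1 → Relation.Join (Relation.ReflTransGen r) a b := by
    rintro ⟨a, ha⟩ ⟨b, hb⟩ hab
    simp only at hab
    have h1 := h.adj_le hab p
    rcases lt_trichotomy (G.dist p a) (G.dist p b) with hlt | heq | hlt
    · exact eqv.symm (single _ _ ⟨hab.symm, by simp only; omega⟩)
    · obtain ⟨e, hae, hbe, hed⟩ := h.TC hab heq
      have heA : e ∈ A := two e a b ha hb hab.ne hae.symm hbe.symm
      exact eqv.trans (single ⟨a, ha⟩ ⟨e, heA⟩ ⟨hae, hed⟩)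
        (eqv.symm (single ⟨b, hb⟩ ⟨e, heA⟩ ⟨hbe, by simp only; omega⟩))
    · exact single _ _ ⟨hab, by simp only; omega⟩
  have all : ∀ n, ∀ z : A, G.dist x z.1 = n →
      Relation.Join (Relation.ReflTransGen r) ⟨x, hx⟩ z := by
    intro n
    induction n with
    | zero =>
      intro z hz
      have : z = ⟨x, hx⟩ := Subtype.ext (h.eq_of_dist hz).symm
      rw [this]
      exact eqv.refl _
    | succ n ih =>
      intro z hz
      have hne : x ≠ z.1 := by intro e; rw [e] at hz; simp at hz
      obtain ⟨v, hv, hvd⟩ := h.exists_toward hne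
      have hvA : v ∈ A := star z.1 z.2 v (by rw [dist_of_adj hv]; exact hvd)
      exact eqv.trans (ih ⟨v, hvA⟩ (by simp only; omega)) (adj ⟨v, hvA⟩ z hv)
  have : ∃ g : A, ∀ y : A, G.dist p g.1 ≤ G.dist p y.1 := by
    have : Nonempty A := ⟨⟨x, hx⟩⟩
    have hwf := (measure (fun y : A => G.dist p y.1)).wf
    refine ⟨hwf.min Set.univ Set.univ_nonempty, fun y => ?_⟩
    exact not_lt.1 (hwf.not_lt_min Set.univ (Set.mem_univ y))
  obtain ⟨g, hg⟩ := this
  have gnf : ∀ z, Relation.ReflTransGen r g z → z = g := by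
    intro z hz
    rcases Relation.ReflTransGen.cases_head hz with h1 | ⟨w, ⟨_, hw⟩, _⟩
    · exact h1.symm
    · have := hg w
      omega
  have len : ∀ y z : A, Relation.ReflTransGen r y z →
      G.dist p z.1 + G.dist z.1 y.1 ≤ G.dist p y.1 := by
    intro y z hyz
    induction hyz with
    | refl => simp
    | @tail b c _ hbc ih =>
      have h1 := h.tri c.1 b.1 y.1
      have h2 := dist_of_adj hbc.1.symm
      have h3 := hbc.2
      omega
  refine ⟨g.1, g.2, fun y hy => ?_⟩
  obtain ⟨z, hgz, hyz⟩ := eqv.trans (eqv.symm (all _ g rfl)) (all _ ⟨y, hy⟩ rfl)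
  rw [gnf z hgz] at hyz
  have h1 := len _ _ hyz
  have h2 := h.tri p g.1 y
  simp only at h1
  omega

theorem gated_inter (h : IsSWM G) {A B : Set V} (hA : Gated G A) (hB : Gated G B)
    (hne : (A ∩ B).Nonempty) : Gated G (A ∩ B) := by
  obtain ⟨x, hx⟩ := hne
  refine h.gated_of_star hx (fun z hz w hw => ?_) (fun v a b ha hb hab hva hvb => ?_)
  · exact ⟨h.gated_convex hA hx.1 hz.1 hw, h.gated_convex hB hx.2 hz.2 hw⟩
  · exact ⟨h.gated_two hA ha.1 hb.1 hab hva hvb, h.gated_two hB ha.2 hb.2 hab hva hvb⟩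

end IsSWM

namespace IsSWM

variable {G : SimpleGraph V}

/-! ### Quads -/

theorem dist_le_two (h : IsSWM G) {a b c : V} (e : G.Adj a b) (f : G.Adj b c) :
    G.dist a c ≤ 2 := by
  have := h.tri a b c
  rw [dist_of_adj e, dist_of_adj f] at this
  exact this

theorem near_of_line (h : IsSWM G) {x s s' u : V} (hs : G.Adj s x) (hs' : G.Adj s' x)
    (e : G.Adj s s') (hd : G.dist s u ≤ G.dist x u) : G.dist s' u ≤ G.dist x u := by
  have h1 := h.adj_le e u
  rw [dcomm G u s, dcomm G u s'] at h1
  rcases hd.lt_or_eq with hlt | heq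
  · omega
  · obtain ⟨t, hst, hxt, ht⟩ := h.TC hs (u := u) (by grind [dcomm])
    rcases h.K4 hs e.symm hs' hst.symm hxt.symm with rfl | h2
    · grind [dcomm]
    · have := h.adj_le h2 u
      grind [dcomm]

theorem exists_on_line (h : IsSWM G) {x s z : V} (hs : G.Adj s x)
    (hd : G.dist s z ≤ G.dist x z) :
    ∃ s', (s' = s ∨ G.Adj s' s) ∧ G.Adj s' x ∧ G.dist s' z + 1 = G.dist x z := by
  have h1 := h.adj_le hs z
  rcases hd.lt_or_eq with hlt | heq
  · exact ⟨s, Or.inl rfl, hs, by grind [dcomm]⟩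
  · obtain ⟨t, hst, hxt, ht⟩ := h.TC hs (u := z) (by grind [dcomm])
    exact ⟨t, Or.inr hst.symm, hxt.symm, by grind [dcomm]⟩

theorem exists_on_line_two (h : IsSWM G) {p c z : V} (hp : G.dist p z = 2) (hc : G.Adj c p)
    (hd : G.dist c z ≤ 2) : ∃ c', (c' = c ∨ G.Adj c' c) ∧ G.Adj c' p ∧ G.Adj c' z := by
  obtain ⟨s, h1, h2, h3⟩ := h.exists_on_line (x := p) (s := c) (z := z)
    hc (by omega)
  exact ⟨s, h1, h2, adj_of_dist (by omega)⟩

/-- Being equal or adjacent is transitive on the neighbours of `p`. -/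
theorem line_trans (h : IsSWM G) {p a b c : V} (ha : G.Adj a p) (hb : G.Adj b p)
    (hc : G.Adj c p) (hab : a = b ∨ G.Adj a b) (hbc : b = c ∨ G.Adj b c) :
    a = c ∨ G.Adj a c := by
  rcases hab with rfl | hab
  · exact hbc
  · rcases hbc with rfl | hbc
    · exact Or.inr hab
    · exact h.K4 hb hab ha hbc.symm hc

theorem quad_share_two (h : IsSWM G) {p q z a b c : V} (hq : G.dist p q = 2)
    (hz : G.dist p z = 2) (hap : G.Adj a p) (hbp : G.Adj b p) (haq : G.Adj a q)
    (hbq : G.Adj b q) (haz : G.Adj a z) (hbz : G.Adj b z) (hab : a ≠ b)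
    (hcp : G.Adj c p) (hcq : G.Adj c q) : G.dist c z ≤ 2 := by
  by_contra hcz
  have h3 : G.dist c z = 3 := by
    have := h.tri c p z
    have := dist_of_adj hcp
    omega
  have hqz : G.dist q z = 2 := by
    refine (h.adj_or_two haq.symm haz ?_).resolve_left fun e => hcz (h.dist_le_two hcq e)
    rintro rfl
    exact hcz (by rw [dist_of_adj hcq]; omega)
  have hac : G.dist a c = 2 := by
    refine (h.adj_or_two hap hcp.symm ?_).resolve_left
      fun e => hcz (h.dist_le_two e.symm haz)
    rintro rfl
    exact hcz (by rw [dist_of_adj haz]; omega)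
  have hbc : G.dist b c = 2 := by
    refine (h.adj_or_two hbp hcp.symm ?_).resolve_left
      fun e => hcz (h.dist_le_two e.symm hbz)
    rintro rfl
    exact hcz (by rw [dist_of_adj hbz]; omega)
  have hab2 : G.dist a b = 2 := by
    refine (h.adj_or_two hap hbp.symm hab).resolve_left fun e => ?_
    rcases h.K4 e hap.symm hbp.symm haq.symm hbq.symm with rfl | e'
    · simp at hq
    · rw [dist_of_adj e'] at hq
      omega
  exact h.k33 ⟨p, q, z, a, b, c, hap.symm, hbp.symm, hcp.symm, haq.symm, hbq.symm, hcq.symm,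
    haz.symm, hbz.symm, hq, hz, hqz, hab2, hac, hbc, by rw [dcomm]; exact h3⟩

theorem quad_share_one (h : IsSWM G) {p q z a b b' c : V} (hq : G.dist p q = 2)
    (hz : G.dist p z = 2) (haq : G.Adj a q) (haz : G.Adj a z)
    (hbp : G.Adj b p) (hbq : G.Adj b q) (hb'p : G.Adj b' p) (hb'z : G.Adj b' z)
    (hbb' : G.Adj b b') (hcp : G.Adj c p) (hcq : G.Adj c q) : G.dist c z ≤ 2 := by
  by_contra hcz
  have hqz : G.dist q z = 2 := by
    refine (h.adj_or_two haq.symm haz ?_).resolve_left fun e => hcz (h.dist_le_two hcq e)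
    rintro rfl
    exact hcz (by rw [dist_of_adj hcq]; omega)
  have hqb' : G.dist q b' = 2 := by
    refine (h.adj_or_two hbq.symm hbb' ?_).resolve_left fun e => ?_
    · rintro rfl
      rw [dcomm, dist_of_adj hb'p] at hq
      omega
    · rcases h.K4 hbb' hbp.symm hb'p.symm hbq.symm e with rfl | e'
      · simp at hq
      · rw [dist_of_adj e'] at hq
        omega
  obtain ⟨y, hzy, hb'y, hy⟩ := h.TC hb'z.symm (u := q) (by omega)
  have hqy : G.Adj q y := adj_of_dist (by omega)
  have hcb' : G.dist c b' = 2 := by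
    have := h.dist_le_two hcp hb'p.symm
    have := h.adj_le hb'z c
    omega
  have hcy : G.dist c y = 2 := by
    have := h.dist_le_two hcq hqy
    have := h.adj_le hzy c
    omega
  obtain ⟨e, hb'e, hye, he⟩ := h.TC hb'y (u := c) (by omega)
  rcases h.K4 hb'y hb'z.symm hzy hb'e.symm hye.symm with rfl | hze
  · omega
  · have := h.adj_le hze c
    omega

theorem quad_share_line (h : IsSWM G) {p q z a b a' b' c : V} (hq : G.dist p q = 2)
    (hz : G.dist p z = 2) (hap : G.Adj a p) (haq : G.Adj a q) (ha'p : G.Adj a' p)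
    (ha'z : G.Adj a' z) (hbp : G.Adj b p) (hbq : G.Adj b q) (hb'p : G.Adj b' p)
    (hb'z : G.Adj b' z) (hab : ¬ (a = b ∨ G.Adj a b)) (haa' : a = a' ∨ G.Adj a a')
    (hbb' : b = b' ∨ G.Adj b b') (hcp : G.Adj c p) (hcq : G.Adj c q) : G.dist c z ≤ 2 := by
  have hab' : ¬ (a = b' ∨ G.Adj a b') := fun e =>
    hab (h.line_trans hap hb'p hbp e (hbb'.imp Eq.symm fun x => x.symm))
  rcases haa' with rfl | haa'
  · rcases hbb' with rfl | hbb'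
    · exact h.quad_share_two hq hz hap hbp haq hbq ha'z hb'z (fun e => hab (Or.inl e)) hcp hcq
    · exact h.quad_share_one hq hz haq ha'z hbp hbq hb'p hb'z hbb' hcp hcq
  rcases hbb' with rfl | hbb'
  · exact h.quad_share_one hq hz hbq hb'z hap haq ha'p ha'z haa' hcp hcq
  by_cases haz : G.Adj a z
  · exact h.quad_share_one hq hz haq haz hbp hbq hb'p hb'z hbb' hcp hcq
  have hd1 : G.dist a z = 2 := by
    refine (h.adj_or_two haa' ha'z ?_).resolve_left haz
    rintro rfl
    rw [dcomm, dist_of_adj hap] at hz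
    omega
  have hd2 : G.dist a b' = 2 :=
    (h.adj_or_two hap hb'p.symm fun e => hab' (Or.inl e)).resolve_left
      fun e => hab' (Or.inr e)
  obtain ⟨y, hzy, hb'y, hy⟩ := h.TC hb'z.symm (u := a) (by omega)
  have hay : G.Adj a y := adj_of_dist (by omega)
  have hpy : G.dist p y = 2 := by
    refine (h.adj_or_two hap.symm hay ?_).resolve_left fun e => ?_
    · rintro rfl
      rw [dcomm, dist_of_adj hzy] at hz
      omega
    · rcases h.K4 hb'y hb'p.symm e hb'z.symm hzy with rfl | e'
      · simp at hz
      · rw [dist_of_adj e'] at hz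
        omega
  have h1 := h.quad_share_one hq hpy haq hay hbp hbq hb'p hb'y hbb' hcp hcq
  obtain ⟨c', hc', hc'p, hc'y⟩ := h.exists_on_line_two hpy hcp h1
  have h2 := h.quad_share_one hpy hz hb'y hb'z hap hay ha'p ha'z haa' hc'p hc'y
  rcases hc' with rfl | hc'
  · exact h2
  · rw [← hz] at h2 ⊢
    exact h.near_of_line hc'p hcp hc' h2

/-- Two vertices at distance two from `p` which are near two common lines through `p` are near
the same lines through `p`. -/
theorem quad_near (h : IsSWM G) {p q z a b c : V} (hq : G.dist p q = 2)
    (hz : G.dist p z = 2) (hap : G.Adj a p) (hbp : G.Adj b p) (hab : ¬ (a = b ∨ G.Adj a b))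
    (haq : G.dist a q ≤ 2) (hbq : G.dist b q ≤ 2) (haz : G.dist a z ≤ 2)
    (hbz : G.dist b z ≤ 2) (hcp : G.Adj c p) (hcq : G.dist c q ≤ 2) : G.dist c z ≤ 2 := by
  obtain ⟨a1, ha1, ha1p, ha1q⟩ := h.exists_on_line_two hq hap haq
  obtain ⟨b1, hb1, hb1p, hb1q⟩ := h.exists_on_line_two hq hbp hbq
  obtain ⟨a2, ha2, ha2p, ha2z⟩ := h.exists_on_line_two hz hap haz
  obtain ⟨b2, hb2, hb2p, hb2z⟩ := h.exists_on_line_two hz hbp hbz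
  obtain ⟨c1, hc1, hc1p, hc1q⟩ := h.exists_on_line_two hq hcp hcq
  have sy : ∀ {x y : V}, (x = y ∨ G.Adj x y) → (y = x ∨ G.Adj y x) := fun e =>
    e.imp Eq.symm fun x => x.symm
  have h1 : ¬ (a1 = b1 ∨ G.Adj a1 b1) := fun e =>
    hab (h.line_trans hap hb1p hbp (h.line_trans hap ha1p hb1p (sy ha1) e) hb1)
  have h2 := h.quad_share_line hq hz ha1p ha1q ha2p ha2z hb1p hb1q hb2p hb2z h1
    (h.line_trans ha1p hap ha2p ha1 (sy ha2)) (h.line_trans hb1p hbp hb2p hb1 (sy hb2))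
    hc1p hc1q
  rcases hc1 with rfl | hc1
  · exact h2
  · rw [← hz] at h2 ⊢
    exact h.near_of_line hc1p hcp hc1 h2

/-- The quad spanned by two vertices at distance two having two common neighbours. -/
theorem exists_quad (h : IsSWM G) {p q a₀ b₀ : V} (hpq : G.dist p q = 2)
    (ha₀p : G.Adj a₀ p) (ha₀q : G.Adj a₀ q) (hb₀p : G.Adj b₀ p) (hb₀q : G.Adj b₀ q)
    (hne : a₀ ≠ b₀) :
    ∃ Q : Set V, Gated G Q ∧ p ∈ Q ∧ q ∈ Q ∧ ∀ u ∈ Q, ∀ v ∈ Q, G.dist u v ≤ 2 := by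
  have sy : ∀ {x y : V}, (x = y ∨ G.Adj x y) → (y = x ∨ G.Adj y x) := fun e =>
    e.imp Eq.symm fun x => x.symm
  have hab : ¬ (a₀ = b₀ ∨ G.Adj a₀ b₀) := by
    rintro (e | e)
    · exact hne e
    · rcases h.K4 e ha₀p.symm hb₀p.symm ha₀q.symm hb₀q.symm with rfl | e'
      · simp at hpq
      · rw [dist_of_adj e'] at hpq
        omega
  have other : ∀ s, G.Adj s p → ∃ t, G.Adj t p ∧ G.Adj t q ∧ ¬ (s = t ∨ G.Adj s t) := by
    intro s hs
    by_cases h1 : s = a₀ ∨ G.Adj s a₀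
    · exact ⟨b₀, hb₀p, hb₀q, fun e => hab (h.line_trans ha₀p hs hb₀p (sy h1) e)⟩
    · exact ⟨a₀, ha₀p, ha₀q, h1⟩
  let Q : Set V := {z | z = p ∨ (G.Adj z p ∧ G.dist z q ≤ 2) ∨
    (G.dist p z = 2 ∧ ∀ c, G.Adj c p → (G.dist c q ≤ 2 ↔ G.dist c z ≤ 2))}
  have mem2 : ∀ z s t, G.dist p z = 2 → G.Adj s p → G.Adj t p → ¬ (s = t ∨ G.Adj s t) →
      G.dist s q ≤ 2 → G.dist t q ≤ 2 → G.dist s z ≤ 2 → G.dist t z ≤ 2 → z ∈ Q := by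
    intro z s t hz hs ht hst hsq htq hsz htz
    refine Or.inr (Or.inr ⟨hz, fun c hc => ⟨fun hcq => ?_, fun hcz => ?_⟩⟩)
    · exact h.quad_near hpq hz hs ht hst hsq htq hsz htz hc hcq
    · exact h.quad_near hz hpq hs ht hst hsz htz hsq htq hc hcz
  have memN : ∀ z ∈ Q, G.Adj z p → G.dist z q ≤ 2 := by
    rintro z (rfl | ⟨-, h1⟩ | ⟨h1, -⟩) hz
    · exact absurd hz (G.loopless.irrefl _)
    · exact h1
    · rw [dcomm, dist_of_adj hz] at h1
      omega
  have memT : ∀ z ∈ Q, G.dist p z = 2 →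
      ∀ c, G.Adj c p → (G.dist c q ≤ 2 ↔ G.dist c z ≤ 2) := by
    rintro z (rfl | ⟨h1, -⟩ | ⟨-, h1⟩) hz
    · simp at hz
    · rw [dcomm, dist_of_adj h1] at hz
      omega
    · exact h1
  have dQ : ∀ z ∈ Q, G.dist p z ≤ 2 := by
    rintro z (rfl | ⟨h1, -⟩ | ⟨h1, -⟩)
    · simp
    · rw [dcomm, dist_of_adj h1]
      omega
    · omega
  have pQ : p ∈ Q := Or.inl rfl
  have qQ : q ∈ Q := Or.inr (Or.inr ⟨hpq, fun c _ => Iff.rfl⟩)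
  have star : ∀ z ∈ Q, ∀ w, G.dist p w + G.dist w z = G.dist p z → w ∈ Q := by
    intro z hz w hw
    by_cases h0 : G.dist p w = 0
    · exact h.eq_of_dist h0 ▸ pQ
    by_cases h1 : G.dist w z = 0
    · exact (h.eq_of_dist h1).symm ▸ hz
    have h2 := dQ z hz
    have hwp : G.Adj w p := (adj_of_dist (by omega)).symm
    exact Or.inr (Or.inl ⟨hwp, (memT z hz (by omega) w hwp).2 (by omega)⟩)
  -- vertices at distance two from `p` with a neighbour in `N(p)` and one farther away
  have close1 : ∀ v s t, s ∈ Q → t ∈ Q → G.Adj s p → G.dist p t = 2 → G.dist p v = 2 →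
      G.Adj v s → G.Adj v t → v ∈ Q := by
    intro v s t hs ht hsp htd hvd hvs hvt
    have hsN := memN s hs hsp
    obtain ⟨e, hve, hte, he⟩ := h.TC hvt (u := p) (by omega)
    have hep : G.Adj e p := (adj_of_dist (by omega)).symm
    have heN := (memT t ht htd e hep).2 (by rw [dist_of_adj hte.symm]; omega)
    by_cases hes : e = s
    · subst hes
      obtain ⟨b, hbp, hbq, hbs⟩ := other e hep
      have h1 := (memT t ht htd b hbp).1 (by rw [dist_of_adj hbq]; omega)
      obtain ⟨b', hb', hb'p, hb't⟩ := h.exists_on_line_two htd hbp h1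
      refine mem2 v e b' hvd hep hb'p ?_ heN ?_ ?_ ?_
      · exact fun e' => hbs (h.line_trans hep hb'p hbp e' hb')
      · exact (memT t ht htd b' hb'p).2 (by rw [dist_of_adj hb't]; omega)
      · rw [dist_of_adj hvs.symm]; omega
      · exact h.dist_le_two hb't hvt.symm
    · refine mem2 v e s hvd hep hsp ?_ heN hsN ?_ ?_
      · rintro (e' | e')
        · exact hes e'
        · rcases h.K4 e' hep.symm hsp.symm hve hvs with rfl | e''
          · simp at hvd
          · rw [dist_of_adj e''] at hvd
            omega
      · rw [dist_of_adj hve.symm]; omega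
      · rw [dist_of_adj hvs.symm]; omega
  have two : ∀ v s t, s ∈ Q → t ∈ Q → s ≠ t → G.Adj v s → G.Adj v t → v ∈ Q := by
    intro v s t hs ht hst hvs hvt
    by_cases hv0 : v = p
    · exact hv0 ▸ pQ
    have ne0 : ∀ r, ¬ G.Adj v p → G.Adj v r → G.dist p r ≠ 0 := by
      intro r h1 h2 h3
      rw [← h.eq_of_dist h3] at h2
      exact h1 h2
    have hds := dQ s hs
    have hdt := dQ t ht
    have hvle := h.adj_le hvs p
    have hvle' := h.adj_le hvt p
    by_cases hvp : G.Adj v p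
    · -- `v` adjacent to `p`
      refine Or.inr (Or.inl ⟨hvp, ?_⟩)
      have key : ∀ r ∈ Q, r ≠ p → G.Adj v r → G.dist v q ≤ 2 := by
        intro r hr hrp hvr
        by_cases hr1 : G.Adj r p
        · have h1 := memN r hr hr1
          rw [← hpq] at h1 ⊢
          exact h.near_of_line hr1 hvp hvr.symm h1
        · have h2 : G.dist p r = 2 :=
            (h.adj_or_two hvp.symm hvr hrp.symm).resolve_left fun e => hr1 e.symm
          exact (memT r hr h2 v hvp).2 (by rw [dist_of_adj hvr]; omega)
      by_cases hsp : s = p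
      · exact key t ht (fun e => hst (hsp.trans e.symm)) hvt
      · exact key s hs hsp hvs
    have hs0 := ne0 s hvp hvs
    have ht0 := ne0 t hvp hvt
    have hv0' : G.dist p v ≠ 0 := fun e => hv0 (h.eq_of_dist e).symm
    have hv1 : G.dist p v ≠ 1 := fun e => hvp (adj_of_dist e).symm
    by_cases hv2 : G.dist p v = 2
    · by_cases hs1 : G.dist p s = 1
      · have hsp := (adj_of_dist hs1).symm
        by_cases ht1 : G.dist p t = 1
        · have htp := (adj_of_dist ht1).symm
          refine mem2 v s t hv2 hsp htp ?_ (memN s hs hsp) (memN t ht htp) ?_ ?_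
          · rintro (e' | e')
            · exact hst e'
            · rcases h.K4 e' hsp.symm htp.symm hvs hvt with e'' | e''
              · exact hv0 e''.symm
              · exact hvp e''.symm
          · rw [dist_of_adj hvs.symm]; omega
          · rw [dist_of_adj hvt.symm]; omega
        · exact close1 v s t hs ht hsp (by omega) hv2 hvs hvt
      · by_cases ht1 : G.dist p t = 1
        · exact close1 v t s ht hs (adj_of_dist ht1).symm (by omega) hv2 hvt hvs
        · obtain ⟨e, hve, hse, he⟩ := h.TC hvs (u := p) (by omega)
          have hep : G.Adj e p := (adj_of_dist (by omega)).symm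
          have heN := (memT s hs (by omega) e hep).2 (by rw [dist_of_adj hse.symm]; omega)
          exact close1 v e s (Or.inr (Or.inl ⟨hep, heN⟩)) hs hep (by omega) hv2 hve hvs
    · exfalso
      have hsd : G.dist p s = 2 := by omega
      have htd : G.dist p t = 2 := by omega
      obtain ⟨hst2, e, hse, hte, he⟩ := h.QC hvs hvt hst (u := p) (by omega) (by omega)
      have hep : G.Adj e p := (adj_of_dist (by omega)).symm
      obtain ⟨b, hbp, hbq, hbe⟩ := other e hep
      have hbN : G.dist b q ≤ 2 := by rw [dist_of_adj hbq]; omega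
      obtain ⟨f, hf, hfp, hfs⟩ := h.exists_on_line_two hsd hbp ((memT s hs hsd b hbp).1 hbN)
      obtain ⟨f', hf', hf'p, hf't⟩ :=
        h.exists_on_line_two htd hbp ((memT t ht htd b hbp).1 hbN)
      have hvf : G.dist v f = 2 := by
        have := h.dist_le_two hvs hfs.symm
        have := h.adj_le hfp v
        grind [dcomm]
      have hvf' : G.dist v f' = 2 := by
        have := h.dist_le_two hvt hf't.symm
        have := h.adj_le hf'p v
        grind [dcomm]
      have hve : G.dist v e = 2 := by
        have := h.dist_le_two hvs hse
        have := h.adj_le hep v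
        grind [dcomm]
      rcases h.line_trans hfp hbp hf'p hf (sy hf') with e' | e'
      · subst e'
        have hef : G.dist e f = 2 := by
          rcases Classical.em (e = f) with e' | e'
          · exact absurd (h.line_trans hep hfp hbp (Or.inl e') hf) hbe
          · exact (h.adj_or_two hep hfp.symm e').resolve_left fun e'' =>
              hbe (h.line_trans hep hfp hbp (Or.inr e'') hf)
        exact h.k33 ⟨s, t, p, e, f, v, hse, hfs.symm, hvs.symm, hte, hf't.symm, hvt.symm,
          hep.symm, hfp.symm, hst2, by rw [dcomm]; exact hsd, by rw [dcomm]; exact htd, hef,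
          by rw [dcomm]; exact hve, by rw [dcomm]; exact hvf, by omega⟩
      · obtain ⟨x, hfx, hf'x, hx⟩ := h.TC e' (u := v) (by omega)
        rcases h.K4 e' hfp.symm hf'p.symm hfx.symm hf'x.symm with rfl | e''
        · grind [dcomm]
        · have := h.adj_le e'' v
          grind [dcomm]
  refine ⟨Q, h.gated_of_star pQ star two, pQ, qQ, fun u hu v hv => ?_⟩
  have hud := dQ u hu
  have hvd := dQ v hv
  by_cases hu0 : u = p
  · rw [hu0]; exact hvd
  by_cases hv0 : v = p
  · rw [hv0, dcomm]; exact hud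
  have hu0' : G.dist p u ≠ 0 := fun e => hu0 (h.eq_of_dist e).symm
  have hv0' : G.dist p v ≠ 0 := fun e => hv0 (h.eq_of_dist e).symm
  by_cases hu1 : G.dist p u = 1
  · have hup := (adj_of_dist hu1).symm
    by_cases hv1 : G.dist p v = 1
    · exact h.dist_le_two hup (adj_of_dist hv1)
    · exact (memT v hv (by omega) u hup).1 (memN u hu hup)
  have hu2 : G.dist p u = 2 := by omega
  by_cases hv1 : G.dist p v = 1
  · have hvp := (adj_of_dist hv1).symm
    rw [dcomm]
    exact (memT u hu hu2 v hvp).1 (memN v hv hvp)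
  have hv2 : G.dist p v = 2 := by omega
  by_contra huv
  have hNu := memT u hu hu2
  have hNv := memT v hv hv2
  have ha₀N : G.dist a₀ q ≤ 2 := by rw [dist_of_adj ha₀q]; omega
  have hb₀N : G.dist b₀ q ≤ 2 := by rw [dist_of_adj hb₀q]; omega
  obtain ⟨v1, hv1a, hv1p, hv1v⟩ := h.exists_on_line_two hv2 ha₀p ((hNv a₀ ha₀p).1 ha₀N)
  obtain ⟨v2, hv2b, hv2p, hv2v⟩ := h.exists_on_line_two hv2 hb₀p ((hNv b₀ hb₀p).1 hb₀N)
  have hv12 : ¬ (v1 = v2 ∨ G.Adj v1 v2) := fun e =>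
    hab (h.line_trans ha₀p hv2p hb₀p (h.line_trans ha₀p hv1p hv2p (sy hv1a) e) hv2b)
  have near : ∀ w, G.Adj w p → G.Adj w v → G.dist u w ≤ 2 := by
    intro w hw hwv
    rw [dcomm]
    exact (hNu w hw).1 ((hNv w hw).2 (by rw [dist_of_adj hwv]; omega))
  have hd1 := near v1 hv1p hv1v
  have hd2 := near v2 hv2p hv2v
  have ha1 := h.adj_le hv1v u
  have ha2 := h.adj_le hv2v u
  obtain ⟨-, y, hv1y, hv2y, hy⟩ := h.QC hv1v.symm hv2v.symm (fun e => hv12 (Or.inl e))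
    (u := u) (by omega) (by omega)
  have huy : G.Adj u y := adj_of_dist (by omega)
  have hpy : G.dist p y = 2 := by
    refine (h.adj_or_two hv1p.symm hv1y ?_).resolve_left fun e => ?_
    · rintro rfl
      rw [dcomm, dist_of_adj huy] at hu2
      omega
    · exact hv12 (h.K4 e hv1p hv1y hv2p hv2y)
  obtain ⟨e, hue, hye, he⟩ := h.TC huy (u := p) (by omega)
  have hep : G.Adj e p := (adj_of_dist (by omega)).symm
  have hev : G.dist e v ≤ 2 :=
    (hNv e hep).1 ((hNu e hep).2 (by rw [dist_of_adj hue.symm]; omega))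
  have hev1 : ¬ G.Adj e v := fun e' => huv (h.dist_le_two hue e')
  have hve2 : G.dist v e = 2 := by
    have h0 : G.dist e v ≠ 0 := fun e' => by
      rw [h.eq_of_dist e'] at hue
      exact huv (by rw [dist_of_adj hue]; omega)
    have h1 : G.dist e v ≠ 1 := fun e' => hev1 (adj_of_dist e')
    grind [dcomm]
  have hvy2 : G.dist v y = 2 := by
    refine (h.adj_or_two hv1v.symm hv1y ?_).resolve_left fun e' =>
      huv (h.dist_le_two huy e'.symm)
    rintro rfl
    exact huv (by rw [dist_of_adj huy]; omega)
  obtain ⟨w, hyw, hew, hw⟩ := h.TC hye (u := v) (by omega)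
  have hwv : G.Adj w v := (adj_of_dist (by omega)).symm
  rcases h.K4 hye huy hue hyw.symm hew.symm with rfl | e'
  · exact huv (by rw [dist_of_adj hwv]; omega)
  · exact huv (h.dist_le_two e' hwv)

theorem quad_far (h : IsSWM G) {Q : Set V} (hQ : Gated G Q)
    (hd : ∀ u ∈ Q, ∀ v ∈ Q, G.dist u v ≤ 2) {x c v : V} (hc : c ∈ Q) (hv : v ∈ Q)
    (hxv : G.dist x v = G.dist x c + 2) : IsGate G Q x c := by
  obtain ⟨g, hg, hg'⟩ := hQ x
  have h1 := hg' c hc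
  have h2 := hg' v hv
  have h3 := hd g hg v hv
  have := h.eq_of_dist (show G.dist g c = 0 by omega)
  subst this
  exact ⟨hg, hg'⟩

end IsSWM

namespace IsSWM

variable {G : SimpleGraph V}

/-! ### Strict pairs -/

/-- The pair `(x, z)` is strict if along every upward edge `uw` of the interval `I(x, z)` (seen
from `x`) a new line through `x` comes into sight. -/
def Strict (G : SimpleGraph V) (x z : V) : Prop :=
  ∀ w u, G.dist x w + G.dist w z = G.dist x z → G.Adj u w → G.dist x u + 1 = G.dist x w →
    ∃ s, G.Adj s x ∧ G.dist s w + 1 = G.dist x w ∧ G.dist s u = G.dist x u + 1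

theorem exists_sharp (h : IsSWM G) {x u w s : V} (hs : G.Adj s x)
    (hsw : G.dist s w ≤ G.dist x w) (hsu : G.dist x u < G.dist s u) :
    ∃ s', G.Adj s' x ∧ G.dist s' w + 1 = G.dist x w ∧ G.dist s' u = G.dist x u + 1 := by
  obtain ⟨s', hs', hs'x, hd⟩ := h.exists_on_line hs hsw
  refine ⟨s', hs'x, hd, ?_⟩
  have h1 := h.adj_le hs'x u
  have h2 := h.adj_le hs u
  rw [dcomm G u s', dcomm G u x] at h1
  rcases hs' with rfl | hs'
  · omega
  · by_contra hne
    have := h.near_of_line hs'x hs hs' (u := u) (by omega)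
    omega

theorem Strict.mono (h : IsSWM G) {x z z' : V} (hs : Strict G x z)
    (hz : G.dist x z' + G.dist z' z = G.dist x z) : Strict G x z' := by
  intro w u hw
  have h1 := h.tri w z' z
  have h2 := h.tri x w z
  exact hs w u (by omega)

theorem strict_of_le_one (h : IsSWM G) {x z : V} (hd : G.dist x z ≤ 1) : Strict G x z := by
  intro w u hw hu hxu
  have h0 := h.eq_of_dist (show G.dist x u = 0 by omega)
  subst h0
  exact ⟨w, hu.symm, by simp; omega, by rw [dist_of_adj hu.symm]; simp⟩

theorem near_flat (h : IsSWM G) {x a v s : V} (hav : G.Adj a v) (hd : G.dist x a = G.dist x v)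
    (hs : G.Adj s x) (hsa : G.dist s a ≤ G.dist x a) : G.dist s v ≤ G.dist x v := by
  obtain ⟨s', hs', hs'x, h1⟩ := h.exists_on_line hs hsa
  have h2 := h.adj_le hav s'
  rcases hs' with rfl | hs'
  · omega
  · exact h.near_of_line hs'x hs hs' (by omega)

theorem exists_parallel (h : IsSWM G) {x w : V} : ∀ n : ℕ, ∀ a v, G.dist w v = n → G.Adj a v →
    G.dist x a = G.dist x v → G.dist x w + G.dist w v = G.dist x v →
    ∃ w', G.dist x w' + G.dist w' a = G.dist x a ∧ G.dist x w' = G.dist x w ∧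
      (w' = w ∨ G.Adj w' w) := by
  intro n
  induction n with
  | zero =>
    intro a v hn hav hd hw
    have := h.eq_of_dist hn
    subst this
    exact ⟨a, by simp, hd, Or.inr hav⟩
  | succ n ih =>
    intro a v hn hav hd hw
    have hne : w ≠ v := by rintro rfl; simp at hn
    obtain ⟨v', hv', h1, h2, h3⟩ := h.exists_toward_mid hne hw
    -- it suffices that `v'` lies in the interval between `x` and `a`
    have key : G.Adj v' a → ∃ w', G.dist x w' + G.dist w' a = G.dist x a ∧
        G.dist x w' = G.dist x w ∧ (w' = w ∨ G.Adj w' w) := by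
      intro hv'a
      have h4 := h.adj_le hv'a w
      have h5 := h.tri x w a
      exact ⟨w, by omega, rfl, Or.inl rfl⟩
    by_cases hv'a : G.Adj v' a
    · exact key hv'a
    obtain ⟨c, hac, hvc, hc⟩ := h.TC hav hd
    have hcv' : c ≠ v' := by rintro rfl; exact hv'a hac.symm
    obtain ⟨-, e, hce, hv'e, he⟩ := h.QC hvc hv'.symm hcv' (u := x) (by omega) (by omega)
    have had : G.dist a v' = 2 := by
      refine (h.adj_or_two hav hv'.symm ?_).resolve_left fun e => hv'a e.symm
      rintro rfl
      omega
    have hae : G.dist a e = 2 := by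
      have := h.dist_le_two hac hce
      have := h.tri x e a
      rw [dcomm G e a] at this
      omega
    obtain ⟨a', hv'a', hea', ha'⟩ := h.TC hv'e (u := a) (by omega)
    have haa' : G.Adj a a' := adj_of_dist (by omega)
    have h4 := h.adj_le haa' x
    have h5 := h.adj_le hea' x
    obtain ⟨w', h6, h7, h8⟩ := ih a' v' (by omega) hv'a'.symm (by omega) (by omega)
    have h9 := h.adj_le haa' w'
    have h10 := h.tri x w' a
    exact ⟨w', by omega, h7, h8⟩

theorem Strict.flat (h : IsSWM G) {x a v : V} (hs : Strict G x a) (hav : G.Adj a v)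
    (hd : G.dist x a = G.dist x v) : Strict G x v := by
  intro w u hw hu hxu
  obtain ⟨w', h1, h2, h3⟩ := h.exists_parallel _ a v rfl hav hd hw
  rcases h3 with rfl | h3
  · exact hs w' u h1 hu hxu
  obtain ⟨u', h4, h5, h6⟩ := h.exists_parallel _ w' w rfl h3 h2
    (show G.dist x u + G.dist u w = G.dist x w by rw [dist_of_adj hu]; omega)
  obtain ⟨s, hsx, hs1, hs2⟩ := hs w' u' h1 (adj_of_dist (by omega)) (by omega)
  refine h.exists_sharp hsx (h.near_flat h3 h2 hsx (by omega)) ?_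
  rcases h6 with rfl | h6
  · omega
  · by_contra hne
    have := h.near_flat h6.symm h5.symm hsx (by omega)
    omega

theorem Strict.exists_other (h : IsSWM G) {x u m w : V} (hs : Strict G x w) (hum : G.Adj u m)
    (hmw : G.Adj m w) (hd : G.dist x u + 2 = G.dist x w) :
    ∃ y, y ≠ m ∧ G.Adj u y ∧ G.Adj y w := by
  have h1 := h.adj_le hum x
  have h2 := h.adj_le hmw x
  obtain ⟨s, hsx, hs1, hs2⟩ := hs w m (by simp) hmw (by omega)
  have h3 := h.adj_le hsx u
  have h4 := h.adj_le hum s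
  rw [dcomm G u s, dcomm G u x] at h3
  have huw : u ≠ w := by rintro rfl; omega
  obtain ⟨-, y, huy, hwy, hy⟩ := h.QC hum.symm hmw huw (u := s) (by omega) (by omega)
  refine ⟨y, ?_, huy, hwy.symm⟩
  rintro rfl
  omega

/-- Two vertices at distance two from the same vertex, one step below: sharp neighbours of the
base point are passed to the opposite side of a square. -/
theorem sharp_opposite (h : IsSWM G) {x c a b v s : V} (hca : G.Adj c a) (hcb : G.Adj c b)
    (hav : G.Adj a v) (hbv : G.Adj b v) (hab : a ≠ b) (hv : G.dist x v = G.dist x c + 2)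
    (hsx : G.Adj s x) (hsb : G.dist s b + 1 = G.dist x b)
    (hsc : G.dist s c = G.dist x c + 1) : G.dist s a = G.dist x a + 1 := by
  have h1 := h.adj_le hca x
  have h2 := h.adj_le hcb x
  have h3 := h.adj_le hav x
  have h4 := h.adj_le hbv x
  have hcv : G.dist c v = 2 := by
    have := h.dist_le_two hca hav
    have := h.tri x c v
    omega
  obtain ⟨Q, hQ, hcQ, hvQ, hdQ⟩ := h.exists_quad hcv hca.symm hav hcb.symm hbv hab
  have hgx := h.quad_far hQ hdQ hcQ hvQ hv
  have haQ : a ∈ Q := h.gated_convex hQ hcQ hvQ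
    (by rw [hcv, dist_of_adj hca, dist_of_adj hav])
  have hbQ : b ∈ Q := h.gated_convex hQ hcQ hvQ
    (by rw [hcv, dist_of_adj hcb, dist_of_adj hbv])
  obtain ⟨h5, -⟩ := h.QC hav.symm hbv.symm hab (u := x) (by omega) (by omega)
  obtain ⟨g, hg, hg'⟩ := hQ s
  have h6 := hg' b hbQ
  have h7 := hg' c hcQ
  have h8 := hgx.2 g hg
  have h9 := h.adj_le hsx g
  rw [dcomm G g s, dcomm G g x] at h9
  have h10 : G.dist g b = 0 := by
    by_contra hne
    have := h.eq_of_dist (show G.dist c g = 0 by omega)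
    subst this
    omega
  have := h.eq_of_dist h10
  subst this
  have h11 := hg' a haQ
  rw [dcomm G g a] at h11
  omega

/-- Every upward chain of length two in the interval has a second middle vertex. -/
def Filled (G : SimpleGraph V) (x z : V) : Prop :=
  ∀ u m w, G.dist x w + G.dist w z = G.dist x z → G.Adj u m → G.Adj m w →
    G.dist x u + 2 = G.dist x w → ∃ y, y ≠ m ∧ G.Adj u y ∧ G.Adj y w

theorem Filled.symm (h : IsSWM G) {x z : V} (hf : Filled G x z) : Filled G z x := by
  intro u m w hw hum hmw hd
  have h1 := h.tri x u z
  have h2 := h.dist_le_two hum hmw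
  have h3 := h.tri x w u
  rw [dcomm G z w, dcomm G w x, dcomm G z x] at hw
  rw [dcomm G z w, dcomm G z u] at hd
  rw [dcomm G w u] at h3
  obtain ⟨y, h4, h5, h6⟩ := hf w m u (by omega) hmw.symm hum.symm (by omega)
  exact ⟨y, h4, h6.symm, h5.symm⟩

theorem Strict.filled (h : IsSWM G) {x z : V} (hs : Strict G x z) : Filled G x z :=
  fun _ _ _ hw hum hmw hd => (hs.mono h hw).exists_other h hum hmw hd

theorem Filled.strict (h : IsSWM G) {x z : V} (hf : Filled G x z) : Strict G x z := by
  have key : ∀ n w u, G.dist x w = n → G.dist x w + G.dist w z = G.dist x z → G.Adj u w →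
      G.dist x u + 1 = G.dist x w →
      ∃ s, G.Adj s x ∧ G.dist s w + 1 = G.dist x w ∧ G.dist s u = G.dist x u + 1 := by
    intro n
    induction n with
    | zero => intro w u hn; omega
    | succ n ih =>
      intro w u hn hw hu hxu
      by_cases h0 : x = u
      · subst h0
        exact ⟨w, hu.symm, by simp at *; omega, by rw [dist_of_adj hu.symm]; simp⟩
      obtain ⟨c, hc, hcd⟩ := h.exists_toward h0
      obtain ⟨a, ha, hca, haw⟩ := hf c u w hw hc hu (by omega)
      have h1 := h.adj_le hca x
      have h2 := h.adj_le haw x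
      have h3 := h.tri x a z
      have h4 := h.tri a w z
      have h5 := dist_of_adj haw
      obtain ⟨s, hsx, hsa, hsc⟩ := ih a c (by omega) (by omega) hca (by omega)
      have h6 := h.sharp_opposite hc hca hu haw ha.symm (by omega) hsx hsa hsc
      have h7 := h.adj_le haw s
      have h8 := h.adj_le hu s
      exact ⟨s, hsx, by omega, h6⟩
  exact fun w u => key _ w u rfl

theorem Strict.symm (h : IsSWM G) {x z : V} (hs : Strict G x z) : Strict G z x :=
  ((hs.filled h).symm h).strict h

theorem exists_quad_of_near (h : IsSWM G) {x y s t : V} (hsx : G.Adj s x) (htx : G.Adj t x)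
    (hst : ¬ (s = t ∨ G.Adj s t)) (hs : G.dist s y ≤ G.dist x y)
    (ht : G.dist t y ≤ G.dist x y) :
    ∃ R : Set V, Gated G R ∧ x ∈ R ∧ s ∈ R ∧ t ∈ R ∧ ∀ u ∈ R, ∀ v ∈ R, G.dist u v ≤ 2 := by
  obtain ⟨s', hs', hs'x, hs'y⟩ := h.exists_on_line hsx hs
  obtain ⟨t', ht', ht'x, ht'y⟩ := h.exists_on_line htx ht
  have hne : s' ≠ t' := by
    rintro rfl
    exact hst (h.line_trans hsx hs'x htx (hs'.imp Eq.symm fun x => x.symm) ht')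
  obtain ⟨-, m, hs'm, ht'm, hm⟩ := h.QC hs'x.symm ht'x.symm hne (u := y)
    (by grind [dcomm]) (by grind [dcomm])
  have hxm : G.dist x m = 2 := by
    have := h.dist_le_two hs'x.symm hs'm
    have := h.tri x m y
    grind [dcomm]
  obtain ⟨R, hR, hxR, hmR, hdR⟩ := h.exists_quad hxm hs'x hs'm ht'x ht'm hne
  have key : ∀ r r', (r' = r ∨ G.Adj r' r) → G.Adj r x → G.Adj r' x → G.Adj r' m → r ∈ R := by
    intro r r' hr hrx hr'x hr'm
    have hr'R : r' ∈ R := h.gated_convex hR hxR hmR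
      (by rw [hxm, dist_of_adj hr'x.symm, dist_of_adj hr'm])
    rcases hr with rfl | hr
    · exact hr'R
    · exact h.gated_two hR hr'R hxR hr'x.ne hr.symm hrx
  exact ⟨R, hR, hxR, key s s' hs' hsx hs'x hs'm, key t t' ht' htx ht'x ht'm, hdR⟩

theorem gate_of_near_two (h : IsSWM G) {R : Set V} (hR : Gated G R)
    (hd : ∀ u ∈ R, ∀ v ∈ R, G.dist u v ≤ 2) {x y s t : V} (hxR : x ∈ R) (hsR : s ∈ R)
    (htR : t ∈ R) (hsx : G.Adj s x) (htx : G.Adj t x) (hst : ¬ (s = t ∨ G.Adj s t))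
    (hs : G.dist s y ≤ G.dist x y) (ht : G.dist t y ≤ G.dist x y) :
    ∃ m, IsGate G R y m ∧ G.dist m x = 2 := by
  obtain ⟨m, hm, hm'⟩ := hR y
  refine ⟨m, ⟨hm, hm'⟩, ?_⟩
  have h1 := hm' x hxR
  have h2 := hm' s hsR
  have h3 := hm' t htR
  have h4 := hd m hm x hxR
  rw [dcomm] at hs ht
  rw [dcomm G x y] at hs ht
  by_contra hne
  have line : ∀ r, G.Adj r x → G.dist m r + G.dist y m ≤ G.dist y x →
      G.Adj m x ∧ (m = r ∨ G.Adj m r) := by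
    intro r hr h5
    have h6 : G.dist m x ≠ 0 := fun e => by
      have := h.eq_of_dist e
      subst this
      rw [dist_of_adj hr.symm] at h5
      omega
    refine ⟨adj_of_dist (by omega), ?_⟩
    by_cases h7 : G.dist m r = 0
    · exact Or.inl (h.eq_of_dist h7)
    · exact Or.inr (adj_of_dist (by omega))
  obtain ⟨h5, h6⟩ := line s hsx (by omega)
  obtain ⟨-, h7⟩ := line t htx (by omega)
  exact hst (h.line_trans hsx h5 htx (h6.imp Eq.symm fun x => x.symm) h7)

theorem near_of_near_two (h : IsSWM G) {R : Set V} (hR : Gated G R)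
    (hd : ∀ u ∈ R, ∀ v ∈ R, G.dist u v ≤ 2) {x y s t w : V} (hxR : x ∈ R) (hsR : s ∈ R)
    (htR : t ∈ R) (hsx : G.Adj s x) (htx : G.Adj t x) (hst : ¬ (s = t ∨ G.Adj s t))
    (hs : G.dist s y ≤ G.dist x y) (ht : G.dist t y ≤ G.dist x y) (hwR : w ∈ R) :
    G.dist w y ≤ G.dist x y := by
  obtain ⟨m, hm, hmx⟩ := h.gate_of_near_two hR hd hxR hsR htR hsx htx hst hs ht
  have h1 := hm.2 x hxR
  have h2 := hm.2 w hwR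
  have h3 := hd m hm.1 w hwR
  rw [dcomm G w y, dcomm G x y]
  omega

theorem exists_near_below (h : IsSWM G) {R : Set V} (hR : Gated G R)
    (hd : ∀ u ∈ R, ∀ v ∈ R, G.dist u v ≤ 2) {x z a s t : V} (hxR : x ∈ R) (hsR : s ∈ R)
    (htR : t ∈ R) (hsx : G.Adj s x) (htx : G.Adj t x) (hst : ¬ (s = t ∨ G.Adj s t))
    (hs : G.dist s z ≤ G.dist x z) (ht : G.dist t z ≤ G.dist x z) (haz : G.Adj a z)
    (ha : G.dist x a + 1 = G.dist x z) :
    ∃ r ∈ R, G.Adj r x ∧ G.dist r a ≤ G.dist x a := by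
  obtain ⟨m, hm, hmx⟩ := h.gate_of_near_two hR hd hxR hsR htR hsx htx hst hs ht
  obtain ⟨g, hg, hg'⟩ := hR a
  have h1 := hm.2 x hxR
  have h2 := h.adj_le haz m
  have h3 := hg' m hm.1
  have h4 := hg' x hxR
  have h5 := hd g hg x hxR
  by_cases h6 : G.dist g x = 0
  · have := h.eq_of_dist h6
    subst this
    grind [dcomm]
  by_cases h7 : G.dist g x = 1
  · exact ⟨g, hg, adj_of_dist h7, by grind [dcomm]⟩
  · refine ⟨s, hsR, hsx, ?_⟩
    have h8 := hg' s hsR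
    have h9 := hd g hg s hsR
    grind [dcomm]

theorem near_of_near_below (h : IsSWM G) {x y z a s w : V} (haz : G.Adj a z)
    (ha : G.dist x a + 1 = G.dist x z) (hwx : G.Adj w x) (hw : G.dist w z ≤ G.dist x z)
    (hsx : G.Adj s x) (hsz : G.dist s z ≤ G.dist x z) (hsa : G.dist x a < G.dist s a)
    (hsy : G.dist s y ≤ G.dist x y)
    (hay : ∀ r, G.Adj r x → G.dist r a ≤ G.dist x a → G.dist r y ≤ G.dist x y) :
    G.dist w y ≤ G.dist x y := by
  by_cases hws : w = s ∨ G.Adj w s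
  · rcases hws with rfl | hws
    · exact hsy
    · exact h.near_of_line hsx hwx hws.symm hsy
  obtain ⟨R, hR, hxR, hwR, hsR, hdR⟩ := h.exists_quad_of_near hwx hsx hws hw hsz
  obtain ⟨r, hrR, hrx, hra⟩ :=
    h.exists_near_below hR hdR hxR hwR hsR hwx hsx hws hw hsz haz ha
  refine h.near_of_near_two hR hdR hxR hsR hrR hsx hrx ?_ hsy (hay r hrx hra) hwR
  rintro (rfl | e)
  · omega
  · have := h.near_of_line hrx hsx e.symm hra
    omega

end IsSWM

namespace IsSWM

variable {G : SimpleGraph V}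

theorem strict_of_lower (h : IsSWM G) {x a b v v' : V}
    (ih : ∀ v₁ a₁ b₁, G.dist x v₁ < G.dist x v → G.Adj v₁ a₁ → G.Adj v₁ b₁ → a₁ ≠ b₁ →
      G.dist x a₁ + 1 = G.dist x v₁ → G.dist x b₁ + 1 = G.dist x v₁ → Strict G x a₁ →
      Strict G x b₁ → Strict G x v₁)
    (hva : G.Adj v a) (hvb : G.Adj v b) (hab : a ≠ b) (ha : G.dist x a + 1 = G.dist x v)
    (hb : G.dist x b + 1 = G.dist x v) (hsa : Strict G x a) (hsb : Strict G x b)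
    (hv' : G.Adj v v') (hd' : G.dist x v' + 1 = G.dist x v) : Strict G x v' := by
  have below : ∀ {w w'}, Strict G x w → G.Adj w w' → G.dist x w' + 1 = G.dist x w →
      Strict G x w' := fun hs e hd => hs.mono h (by rw [dist_of_adj e.symm]; exact hd)
  by_cases h1 : v' = a
  · exact h1 ▸ hsa
  by_cases h2 : v' = b
  · exact h2 ▸ hsb
  obtain ⟨-, c, hac, hv'c, hc⟩ := h.QC hva hv' (Ne.symm h1) (u := x) (by omega) (by omega)
  obtain ⟨-, c', hbc', hv'c', hc'⟩ := h.QC hvb hv' (Ne.symm h2) (u := x) (by omega) (by omega)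
  have hsc := below hsa hac hc
  by_cases hcc : c ≠ c'
  · exact ih v' c c' (by omega) hv'c hv'c' hcc (by omega) (by omega) hsc (below hsb hbc' hc')
  rw [not_not] at hcc
  subst hcc
  by_cases hx : x = c
  · subst hx
    exact h.strict_of_le_one (by simp at hc; omega)
  obtain ⟨e, hec, he⟩ := h.exists_toward hx
  obtain ⟨a1, ha1c, hea1, ha1a⟩ := hsa.exists_other h hec hac.symm (by omega)
  obtain ⟨b1, hb1c, heb1, hb1b⟩ := hsb.exists_other h hec hbc'.symm (by omega)
  have e1 := h.adj_le hea1 x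
  have e2 := h.adj_le ha1a x
  have e3 := h.adj_le heb1 x
  have e4 := h.adj_le hb1b x
  have hcv : G.dist c v = 2 := by
    have := h.dist_le_two hac.symm hva.symm
    have := h.tri x c v
    omega
  obtain ⟨Q, hQ, hcQ, hvQ, hdQ⟩ := h.exists_quad hcv hac hva.symm hbc' hvb.symm hab
  have hgx := h.quad_far hQ hdQ hcQ hvQ (x := x) (by omega)
  have mid : ∀ {r}, G.Adj r c → G.Adj v r → r ∈ Q := fun e f =>
    h.gated_convex hQ hcQ hvQ (by rw [hcv, dist_of_adj e.symm, dist_of_adj f.symm])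
  have hab1 : a1 ≠ b1 := by
    rintro rfl
    have h3 : a1 ∈ Q := h.gated_two hQ (mid hac hva) (mid hbc' hvb) hab ha1a hb1b
    have h4 := hgx.2 a1 h3
    exact ha1c (h.eq_of_dist (show G.dist c a1 = 0 by omega)).symm
  have hve : G.dist v e = 3 := by
    have h3 := h.adj_le hec v
    have h4 := h.tri x e v
    rw [dcomm G e v] at h4
    rw [dcomm G v c] at h3
    omega
  have hva1 : G.dist v a1 = 2 := by
    have h3 := h.dist_le_two hva ha1a.symm
    have h4 := h.adj_le hea1 v
    omega
  have hvb1 : G.dist v b1 = 2 := by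
    have h3 := h.dist_le_two hvb hb1b.symm
    have h4 := h.adj_le heb1 v
    omega
  obtain ⟨-, v1, ha1v1, hb1v1, hv1⟩ := h.QC hea1 heb1 hab1 (u := v) (by omega) (by omega)
  have hvv1 : G.Adj v v1 := adj_of_dist (by omega)
  have e5 := h.adj_le hvv1 x
  have e6 := h.adj_le ha1v1 x
  have hsv1 : Strict G x v1 := ih v1 a1 b1 (by omega) ha1v1.symm hb1v1.symm hab1 (by omega)
    (by omega) (below hsa ha1a.symm (by omega)) (below hsb hb1b.symm (by omega))
  by_cases h3 : v' = v1
  · exact h3 ▸ hsv1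
  rcases h.adj_or_two hv'.symm hvv1 h3 with h4 | h4
  · exact hsv1.flat h h4.symm (by omega)
  have hev1 : G.dist e v1 = 2 := by
    have := h.dist_le_two hea1 ha1v1
    have := h.tri x e v1
    omega
  obtain ⟨Q1, hQ1, heQ1, hv1Q1, hdQ1⟩ :=
    h.exists_quad hev1 hea1.symm ha1v1 heb1.symm hb1v1 hab1
  have hvQ1 : v ∉ Q1 := fun h5 => by
    have := hdQ1 v h5 e heQ1
    omega
  obtain ⟨g, hg, hg'⟩ := hQ1 v'
  have h5 := hg' e heQ1
  have h6 := hg' v1 hv1Q1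
  have h7 : G.dist v' e = 2 := by
    have h8 := h.dist_le_two hv'c hec.symm
    have h9 := h.tri x e v'
    rw [dcomm G e v'] at h9
    omega
  have h8 := h.tri e g v1
  rw [dcomm G e g] at h8
  have h9 := h.tri v1 g v1
  have h10 : G.dist v' g ≠ 0 := fun h0 => by
    have := h.eq_of_dist h0
    subst this
    exact hvQ1 (h.gated_two hQ1 hg hv1Q1 h3 hv' hvv1)
  have h11 : G.dist g e ≠ 0 := fun h0 => by omega
  have hv'g : G.Adj v' g := adj_of_dist (by omega)
  have hge : G.Adj g e := adj_of_dist (by omega)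
  have hgv1 : G.Adj g v1 := adj_of_dist (by omega)
  have e7 := h.adj_le hge x
  have e8 := h.adj_le hgv1 x
  have hcg : c ≠ g := by
    rintro rfl
    have mid1 : ∀ {r}, G.Adj e r → G.Adj r v1 → r ∈ Q1 := fun e f =>
      h.gated_convex hQ1 heQ1 hv1Q1 (by rw [hev1, dist_of_adj e, dist_of_adj f])
    have h12 : a ∈ Q1 := h.gated_two hQ1 hg (mid1 hea1 ha1v1) ha1c.symm hac ha1a.symm
    have h13 : b ∈ Q1 := h.gated_two hQ1 hg (mid1 heb1 hb1v1) hb1c.symm hbc' hb1b.symm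
    exact hvQ1 (h.gated_two hQ1 h12 h13 hab hva hvb)
  exact ih v' c g (by omega) hv'c hv'g hcg (by omega) (by omega) hsc
    (below hsv1 hgv1.symm (by omega))

theorem strict_of_two (h : IsSWM G) {x : V} : ∀ v a b, G.Adj v a → G.Adj v b → a ≠ b →
    G.dist x a + 1 = G.dist x v → G.dist x b + 1 = G.dist x v → Strict G x a →
    Strict G x b → Strict G x v := by
  have key : ∀ n v a b, G.dist x v = n → G.Adj v a → G.Adj v b → a ≠ b →
      G.dist x a + 1 = G.dist x v → G.dist x b + 1 = G.dist x v → Strict G x a →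
      Strict G x b → Strict G x v := by
    intro n
    induction n using Nat.strong_induction_on with
    | _ n ih =>
    intro v a b hn hva hvb hab ha hb hsa hsb
    have low : ∀ v', G.Adj v v' → G.dist x v' + 1 = G.dist x v → Strict G x v' :=
      fun v' hv' hd' => h.strict_of_lower
        (fun v₁ a₁ b₁ hlt => ih (G.dist x v₁) (by omega) v₁ a₁ b₁ rfl)
        hva hvb hab ha hb hsa hsb hv' hd'
    intro w u hw hu hxu
    by_cases hwv : w = v
    · subst hwv
      have new : ∀ a, G.Adj w a → G.dist x a + 1 = G.dist x w → Strict G x a → a ≠ u →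
          ∃ s, G.Adj s x ∧ G.dist s w + 1 = G.dist x w ∧ G.dist s u = G.dist x u + 1 := by
        intro a hwa ha hsa hau
        obtain ⟨-, c, hac, huc, hc⟩ := h.QC hwa hu.symm hau (u := x) (by omega) (by omega)
        obtain ⟨s, hsx, hs1, hs2⟩ := hsa a c (by simp) hac.symm hc
        have h1 := h.sharp_opposite huc.symm hac.symm hu hwa.symm hau.symm (by omega)
          hsx hs1 hs2
        have h2 := h.adj_le hwa s
        exact h.exists_sharp hsx (by omega) (by omega)
      by_cases hau : a = u
      · exact new b hvb hb hsb (fun e => hab (hau.trans e.symm))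
      · exact new a hva ha hsa hau
    · obtain ⟨v', hv', h1, h2, h3⟩ := h.exists_toward_mid hwv hw
      exact low v' hv'.symm h1 w u h3 hu hxu
  exact fun v a b => key _ v a b rfl

/-! ### Hulls of strict pairs -/

/-- For a strict pair `(x, y)`, this is the smallest gated set containing `x` and `y`. -/
def Hull (G : SimpleGraph V) (x y : V) : Set V :=
  {z | Strict G x z ∧ ∀ s, G.Adj s x → G.dist s z ≤ G.dist x z → G.dist s y ≤ G.dist x y}

theorem left_mem_hull (h : IsSWM G) (x y : V) : x ∈ Hull G x y := by
  refine ⟨h.strict_of_le_one (by simp), fun s hs hd => ?_⟩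
  rw [dist_of_adj hs] at hd
  simp at hd

theorem right_mem_hull {x y : V} (hs : Strict G x y) : y ∈ Hull G x y :=
  ⟨hs, fun _ _ => id⟩

theorem gated_hull (h : IsSWM G) (x y : V) : Gated G (Hull G x y) := by
  have star : ∀ z ∈ Hull G x y, ∀ w, G.dist x w + G.dist w z = G.dist x z →
      w ∈ Hull G x y := by
    intro z hz w hw
    refine ⟨hz.1.mono h hw, fun s hs hd => hz.2 s hs ?_⟩
    have := h.tri s w z
    omega
  refine h.gated_of_star (h.left_mem_hull x y) star fun v a b ha hb hab hva hvb => ?_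
  have one : ∀ c, c ∈ Hull G x y → G.Adj v c → G.dist x c + 1 ≠ G.dist x v →
      v ∈ Hull G x y := by
    intro c hc hvc hne
    have h1 := h.adj_le hvc x
    by_cases h2 : G.dist x v = G.dist x c
    · exact ⟨hc.1.flat h hvc.symm h2.symm,
        fun s hs hd => hc.2 s hs (h.near_flat hvc h2 hs hd)⟩
    · exact star c hc v (by rw [dist_of_adj hvc]; omega)
  by_cases ha1 : G.dist x a + 1 = G.dist x v
  swap
  · exact one a ha hva ha1
  by_cases hb1 : G.dist x b + 1 = G.dist x v
  swap
  · exact one b hb hvb hb1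
  refine ⟨h.strict_of_two v a b hva hvb hab ha1 hb1 ha.1 hb.1, fun w hw hwd => ?_⟩
  obtain ⟨-, c, hac, hbc, hc⟩ := h.QC hva hvb hab (u := x) (by omega) (by omega)
  obtain ⟨s, hsx, hs1, hs2⟩ := hb.1 b c (by simp) hbc.symm (by omega)
  have h1 := h.sharp_opposite hac.symm hbc.symm hva.symm hvb.symm hab (by omega) hsx hs1 hs2
  have h2 := h.adj_le hvb s
  exact h.near_of_near_below hva.symm ha1 hw hwd hsx (by omega) (by omega)
    (hb.2 s hsx (by omega)) ha.2

theorem near_mem (h : IsSWM G) {A : Set V} (hA : Gated G A) {x y s : V} (hx : x ∈ A)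
    (hy : y ∈ A) (hs : G.Adj s x) (hd : G.dist s y ≤ G.dist x y) : s ∈ A := by
  obtain ⟨s', hs', hs'x, h1⟩ := h.exists_on_line hs hd
  have h2 : s' ∈ A := h.gated_convex hA hx hy (by rw [dist_of_adj hs'x.symm]; omega)
  rcases hs' with rfl | hs'
  · exact h2
  · exact h.gated_two hA h2 hx hs'x.ne hs'.symm hs

theorem hull_subset_of_near (h : IsSWM G) {A : Set V} (hA : Gated G A) {x y : V} (hx : x ∈ A)
    (near : ∀ s, G.Adj s x → G.dist s y ≤ G.dist x y → s ∈ A) : Hull G x y ⊆ A := by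
  have key : ∀ n z, G.dist x z = n → z ∈ Hull G x y → z ∈ A := by
    intro n
    induction n with
    | zero => intro z hn _; exact h.eq_of_dist hn ▸ hx
    | succ n ih =>
      intro z hn hz
      have low : ∀ z', G.Adj z' z → G.dist x z' + 1 = G.dist x z → z' ∈ A := by
        intro z' hz' hd
        exact ih z' (by omega) (h.gated_convex (h.gated_hull x y) (h.left_mem_hull x y) hz
          (by rw [dist_of_adj hz']; exact hd))
      have hxz : x ≠ z := by rintro rfl; simp at hn
      obtain ⟨z', hz', h1⟩ := h.exists_toward hxz
      by_cases hxz' : x = z'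
      · subst hxz'
        exact near z hz'.symm (hz.2 z hz'.symm (by simp))
      obtain ⟨e, he, h2⟩ := h.exists_toward hxz'
      obtain ⟨a, h3, h4, h5⟩ := hz.1.exists_other h he hz' (by omega)
      have h6 := h.adj_le h4 x
      have h7 := h.adj_le h5 x
      exact h.gated_two hA (low z' hz' h1) (low a h5 (by omega)) h3.symm hz'.symm h5.symm
  exact fun z => key _ z rfl

theorem hull_subset (h : IsSWM G) {A : Set V} (hA : Gated G A) {x y : V} (hx : x ∈ A)
    (hy : y ∈ A) : Hull G x y ⊆ A :=
  h.hull_subset_of_near hA hx fun _ hs hd => h.near_mem hA hx hy hs hd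

theorem dist_le_of_mem_hull (h : IsSWM G) {x : V} : ∀ n y z, G.dist x y = n →
    z ∈ Hull G x y → G.dist x z ≤ n := by
  intro n
  induction n with
  | zero =>
    intro y z hn hz
    by_contra hne
    have hzx : z ≠ x := by rintro rfl; simp at hne
    obtain ⟨s, hs, hd⟩ := h.exists_toward hzx
    have h1 := hz.2 s hs (by grind [dcomm])
    rw [← h.eq_of_dist hn, dist_of_adj hs] at h1
    simp at h1
  | succ n ih =>
    intro y z hn hz
    have hxy : x ≠ y := by rintro rfl; simp at hn
    obtain ⟨y', hy', hd'⟩ := h.exists_toward hxy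
    have hG' := h.gated_hull x y'
    obtain ⟨z', hz', hgz⟩ := hG' z
    have h1 := ih y' z' (by omega) hz'
    have h2 := hgz x (h.left_mem_hull x y')
    rw [dcomm G z x, dcomm G z' x] at h2
    by_contra hlt
    have hzz' : z' ≠ z := by rintro rfl; omega
    obtain ⟨v1, hv1, h3⟩ := h.exists_toward (x := z) hzz'.symm
    have hv1z : z ≠ v1 := by rintro rfl; simp at h3; omega
    obtain ⟨u, hu, h4⟩ := h.exists_toward hv1z
    have h5 := h.tri x u z
    have h6 := h.adj_le hv1 x
    have h7 := h.adj_le hu x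
    rw [dcomm G u z] at h5
    have hzI : ∀ w, G.dist x w + G.dist z w = G.dist x z → Strict G x w := fun w hw =>
      hz.1.mono h (by rw [dcomm G w z]; exact hw)
    obtain ⟨v2, hv2, hz'v2, hv2u⟩ :=
      (hzI u (by omega)).exists_other h hv1.symm hu.symm (by omega)
    have h8 := h.adj_le hz'v2 x
    have h9 := h.adj_le hv2u x
    have h10 := h.adj_le hv2u z
    have h11 := h.adj_le hz'v2 z
    obtain ⟨s1, hs1x, hs1, hs1'⟩ := hzI v1 (by omega) v1 z' (by simp) hv1.symm (by omega)
    obtain ⟨s2, hs2x, hs2, hs2'⟩ := hzI v2 (by omega) v2 z' (by simp) hz'v2 (by omega)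
    have h12 := h.sharp_opposite hv1.symm hz'v2 hu.symm hv2u hv2.symm (by omega) hs2x hs2 hs2'
    have hs12 : ¬ (s1 = s2 ∨ G.Adj s1 s2) := by
      rintro (rfl | e)
      · omega
      · have := h.near_of_line hs1x hs2x e (u := v1) (by omega)
        omega
    have h13 := h.adj_le hu s1
    have h14 := h.adj_le hv2u s2
    have h15 := h.tri s1 u z
    have h16 := h.tri s2 u z
    rw [dcomm G u z] at h15 h16
    have hs1y := hz.2 s1 hs1x (by omega)
    have hs2y := hz.2 s2 hs2x (by omega)
    obtain ⟨R, hR, hxR, hs1R, hs2R, hdR⟩ := h.exists_quad_of_near hs1x hs2x hs12 hs1y hs2y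
    obtain ⟨r, hrR, hrx, hry'⟩ :=
      h.exists_near_below hR hdR hxR hs1R hs2R hs1x hs2x hs12 hs1y hs2y hy' hd'
    have hru : G.dist r u ≤ G.dist x u := h.near_of_near_two hR hdR hxR hs1R hs2R hs1x hs2x
      hs12 (by omega) (by omega) hrR
    have hrz' : ¬ G.dist r z' ≤ G.dist x z' := by
      intro h17
      have h18 : ¬ (r = s1 ∨ G.Adj r s1) := by
        rintro (rfl | e)
        · omega
        · have := h.near_of_line hrx hs1x e h17
          omega
      have h19 := h.adj_le hv1 r
      have := h.near_of_near_two hR hdR hxR hrR hs1R hrx hs1x h18 (y := v1) (by omega)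
        (by omega) hs2R
      omega
    obtain ⟨t, ht, htx, htu⟩ := h.exists_on_line hrx hru
    have hty' : G.dist t y' ≤ G.dist x y' := by
      rcases ht with rfl | ht
      · exact hry'
      · exact h.near_of_line hrx htx ht.symm hry'
    have htz' : ¬ G.dist t z' ≤ G.dist x z' := by
      rcases ht with rfl | ht
      · exact hrz'
      · exact fun e => hrz' (h.near_of_line htx hrx ht e)
    have hz'u : G.dist z' u = 2 := by
      have := h.dist_le_two hv1.symm hu.symm
      have := h.tri x z' u
      omega
    obtain ⟨Q, hQ, hz'Q, huQ, hdQ⟩ := h.exists_quad hz'u hv1 hu.symm hz'v2.symm hv2u hv2.symm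
    have hgx := h.quad_far hQ hdQ hz'Q huQ (x := x) (by omega)
    obtain ⟨v, hv, hv'⟩ := hQ t
    have h17 := hgx.2 v hv
    have h18 := hv' z' hz'Q
    have h19 := hv' u huQ
    have h20 := h.adj_le htx v
    have h21 := h.adj_le htx z'
    rw [dcomm G v t, dcomm G v x] at h20
    rw [dcomm G z' t, dcomm G z' x] at h21
    have h22 := h.tri z' v u
    rw [dcomm G v z'] at h18
    have hz'v : G.Adj z' v := adj_of_dist (by omega)
    have hvu : G.Adj v u := adj_of_dist (by omega)
    have h23 := h.adj_le hvu z
    have h24 := h.adj_le hz'v z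
    have h25 := h.adj_le hvu x
    have hvH : v ∈ Hull G x y' := ⟨hzI v (by omega), fun w hw hwd =>
      h.near_of_near_below hz'v (by omega) hw hwd htx (by omega) (by omega) hty' hz'.2⟩
    have h26 := hgz v hvH
    omega

theorem Strict.square (h : IsSWM G) : ∀ k, ∀ x y u w, Strict G x y → G.dist x y = k + 1 →
    G.Adj u x → G.Adj w y → G.dist u y = k → G.dist x w = k → G.dist u w = k + 1 →
    Strict G u w := by
  intro k
  induction k with
  | zero => intro x y u w _ _ _ _ _ _ hd; exact h.strict_of_le_one (by omega)
  | succ k ih =>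
    intro x y u w hs hk hux hwy huy hxw huw
    have huy0 : u ≠ y := by rintro rfl; simp at huy
    obtain ⟨y', hy', h1⟩ := h.exists_toward huy0
    have h2 := h.adj_le hy' x
    have h3 := h.adj_le hux y'
    rw [dcomm G y' u, dcomm G y' x] at h3
    have hwy' : w ≠ y' := by rintro rfl; omega
    obtain ⟨-, w', hww', hy'w', h4⟩ := h.QC hwy.symm hy'.symm hwy' (u := x) (by omega)
      (by omega)
    have h5 := h.adj_le hww' u
    have h6 := h.adj_le hux w'
    rw [dcomm G w' u, dcomm G w' x] at h6
    have h7 : Strict G u w' := ih x y' u w'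
      (hs.mono h (by rw [dist_of_adj hy']; omega)) (by omega) hux hy'w'.symm (by omega)
      (by omega) (by omega)
    have h8 : Strict G u y := ((hs.symm h).mono h (z' := u)
      (by rw [dcomm G y u, dcomm G y x, dist_of_adj hux]; omega)).symm h
    refine h.strict_of_two w y w' hwy hww' ?_ (by omega) (by omega) h8 h7
    rintro rfl
    omega

theorem exists_hull_eq_of_adj (h : IsSWM G) {x y u : V} (hs : Strict G x y)
    (hu : u ∈ Hull G x y) (hux : G.Adj u x) :
    ∃ w, Strict G u w ∧ G.dist u w = G.dist x y ∧ Hull G u w = Hull G x y := by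
  have h1 := hu.2 u hux (by simp)
  have h2 := h.adj_le hux y
  rw [dcomm G y u, dcomm G y x] at h2
  have hxH := h.left_mem_hull x y
  have hyH := right_mem_hull hs
  have hH := h.gated_hull x y
  by_cases h3 : G.dist u y = G.dist x y
  · have h4 : Strict G u y :=
      ((hs.symm h).flat h hux.symm (by rw [dcomm G y u, dcomm G y x, h3])).symm h
    refine ⟨y, h4, h3, Set.Subset.antisymm (h.hull_subset hH hu hyH)
      (h.hull_subset (h.gated_hull u y) ?_ (right_mem_hull h4))⟩
    obtain ⟨c, huc, hxc, hc⟩ := h.TC hux (u := y) (by rw [dcomm G y u, dcomm G y x, h3])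
    refine h.gated_two (h.gated_hull u y) (h.left_mem_hull u y) (b := c) ?_ huc.ne hux.symm hxc
    exact h.gated_convex (h.gated_hull u y) (h.left_mem_hull u y) (right_mem_hull h4)
      (by rw [dist_of_adj huc]; grind [dcomm])
  · obtain ⟨s, hsy, h4, h5⟩ := hs.symm h x u (by simp) hux (by grind [dcomm])
    have h6 : Strict G u s := Strict.square h (G.dist u y) x y u s hs (by omega) hux hsy rfl
      (by grind [dcomm]) (by grind [dcomm])
    have h7 : s ∈ Hull G x y := h.gated_convex hH hxH hyH
      (by rw [dist_of_adj hsy]; grind [dcomm])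
    refine ⟨s, h6, by grind [dcomm], Set.Subset.antisymm (h.hull_subset hH hu h7)
      (h.hull_subset (h.gated_hull u s) ?_ ?_)⟩
    · exact h.gated_convex (h.gated_hull u s) (h.left_mem_hull u s) (right_mem_hull h6)
        (by rw [dist_of_adj hux]; grind [dcomm])
    · exact h.gated_convex (h.gated_hull u s) (h.left_mem_hull u s) (right_mem_hull h6)
        (by rw [dist_of_adj hsy.symm]; grind [dcomm])

theorem exists_hull_eq (h : IsSWM G) {x y u : V} (hs : Strict G x y) (hu : u ∈ Hull G x y) :
    ∃ w, Strict G u w ∧ G.dist u w = G.dist x y ∧ Hull G u w = Hull G x y := by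
  have key : ∀ n u, G.dist x u = n → u ∈ Hull G x y →
      ∃ w, Strict G u w ∧ G.dist u w = G.dist x y ∧ Hull G u w = Hull G x y := by
    intro n
    induction n with
    | zero =>
      intro u hn _
      have := h.eq_of_dist hn
      subst this
      exact ⟨y, hs, rfl, rfl⟩
    | succ n ih =>
      intro u hn hu
      have hxu : x ≠ u := by rintro rfl; simp at hn
      obtain ⟨u', hu', hd⟩ := h.exists_toward hxu
      obtain ⟨w', h1, h2, h3⟩ := ih u' (by omega) (h.gated_convex (h.gated_hull x y)
        (h.left_mem_hull x y) hu (by rw [dist_of_adj hu']; exact hd))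
      obtain ⟨w, h4, h5, h6⟩ := h.exists_hull_eq_of_adj h1 (u := u) (h3 ▸ hu) hu'.symm
      exact ⟨w, h4, h5.trans h2, h6.trans h3⟩
  exact key _ u rfl hu

theorem dist_le_of_mem_hull₂ (h : IsSWM G) {x y a b : V} (hs : Strict G x y)
    (ha : a ∈ Hull G x y) (hb : b ∈ Hull G x y) : G.dist a b ≤ G.dist x y := by
  obtain ⟨w, -, h2, h3⟩ := h.exists_hull_eq hs ha
  exact h.dist_le_of_mem_hull _ w b h2 (h3 ▸ hb)

theorem strict_of_mem_hull (h : IsSWM G) {x y a b : V} (hs : Strict G x y)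
    (ha : a ∈ Hull G x y) (hb : b ∈ Hull G x y) : Strict G a b := by
  obtain ⟨w, -, -, h3⟩ := h.exists_hull_eq hs ha
  rw [← h3] at hb
  exact hb.1

/-! ### Thick gated sets -/

theorem dist_induce (h : IsSWM G) {A : Set V} (hA : Gated G A) (a b : A) :
    (G.induce A).dist a b = G.dist a.1 b.1 := by
  have key : ∀ n, ∀ b : A, G.dist a.1 b.1 = n → ∃ p : (G.induce A).Walk a b, p.length = n := by
    intro n
    induction n with
    | zero =>
      intro b hn
      have := Subtype.ext (h.eq_of_dist hn)
      subst this
      exact ⟨SimpleGraph.Walk.nil, rfl⟩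
    | succ n ih =>
      intro b hn
      have hab : a.1 ≠ b.1 := by intro e; rw [e] at hn; simp at hn
      obtain ⟨v, hv, hd⟩ := h.exists_toward hab
      have hvA : v ∈ A := h.gated_convex hA a.2 b.2 (by rw [dist_of_adj hv]; exact hd)
      obtain ⟨p, hp⟩ := ih ⟨v, hvA⟩ (by simp only; omega)
      exact ⟨p.concat (show (G.induce A).Adj ⟨v, hvA⟩ b from hv), by simp [hp]⟩
  obtain ⟨p, hp⟩ := key _ b rfl
  refine le_antisymm (hp ▸ SimpleGraph.dist_le p) ?_
  obtain ⟨q, hq⟩ := p.reachable.exists_walk_length_eq_dist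
  rw [← hq]
  exact (SimpleGraph.dist_le (q.map (SimpleGraph.Embedding.induce A).toHom)).trans_eq
    (SimpleGraph.Walk.length_map _ _)

theorem thick_of_strict (h : IsSWM G) {A : Set V} (hG : Gated G A)
    (hs : ∀ a ∈ A, ∀ b ∈ A, Strict G a b) : Thick (G.induce A) := by
  rintro ⟨a, ha⟩ ⟨b, hb⟩ hd
  rw [h.dist_induce hG] at hd
  simp only at hd
  have hsab := hs a ha b hb
  obtain ⟨m, ham, hmb⟩ := h.exists_mid hd
  obtain ⟨n, hnm, han, hnb⟩ := hsab.exists_other h ham hmb (by simp [hd])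
  have mem : ∀ {r}, G.Adj a r → G.Adj r b → r ∈ A := fun e f =>
    h.gated_convex hG ha hb (by rw [dist_of_adj e, dist_of_adj f, hd])
  have hab : a ≠ b := by rintro rfl; simp at hd
  have hab' : ¬ G.Adj a b := fun e => by rw [dist_of_adj e] at hd; omega
  refine ⟨⟨a, ha⟩, ⟨m, mem ham hmb⟩, ⟨b, hb⟩, ⟨n, mem han hnb⟩, ?_, ?_, ?_, ?_, ham, hmb,
    hnb.symm, han.symm, by simpa using hab, by simpa using hnm.symm, hab', fun e => ?_⟩
  · simp [gInterval]
  · simp only [gInterval, Set.mem_ofPred_eq, h.dist_induce hG]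
    rw [dist_of_adj ham, dist_of_adj hmb, hd]
  · simp [gInterval]
  · simp only [gInterval, Set.mem_ofPred_eq, h.dist_induce hG]
    rw [dist_of_adj han, dist_of_adj hnb, hd]
  · have e : G.Adj m n := e
    rcases h.K4 e ham han hmb.symm hnb.symm with e' | e'
    · exact hab e'
    · exact hab' e'

theorem strict_of_thick (h : IsSWM G) {A : Set V} (hA : Gated G A) (hT : Thick (G.induce A))
    {x y : V} (hx : x ∈ A) (hy : y ∈ A) : Strict G x y := by
  refine Filled.strict h fun u m w hw hum hmw hd => ?_
  have h1 := h.dist_le_two hum hmw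
  have h2 := h.tri x u w
  have h3 := h.tri u w y
  have h4 := h.tri x u y
  have huA : u ∈ A := h.gated_convex hA hx hy (by omega)
  have hwA : w ∈ A := h.gated_convex hA hx hy hw
  have huw : G.dist u w = 2 := by omega
  obtain ⟨a, b, c, d, ha, hb, hc, hd', hab, hbc, hcd, hda, hac, hbd, -, -⟩ :=
    hT ⟨u, huA⟩ ⟨w, hwA⟩ (by rw [h.dist_induce hA]; exact huw)
  have key : ∀ r : A, r ∈ gInterval (G.induce A) ⟨u, huA⟩ ⟨w, hwA⟩ → r.1 ≠ u → r.1 ≠ w →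
      r.1 ≠ m → ∃ y, y ≠ m ∧ G.Adj u y ∧ G.Adj y w := by
    intro r hr hru hrw hrm
    simp only [gInterval, Set.mem_ofPred_eq, h.dist_induce hA] at hr
    have h5 : G.dist u r.1 ≠ 0 := fun e => hru (h.eq_of_dist e).symm
    have h6 : G.dist r.1 w ≠ 0 := fun e => hrw (h.eq_of_dist e)
    exact ⟨r.1, hrm, adj_of_dist (by omega), adj_of_dist (by omega)⟩
  by_contra hno
  have cov : ∀ r : A, r ∈ gInterval (G.induce A) ⟨u, huA⟩ ⟨w, hwA⟩ →
      r.1 = u ∨ r.1 = w ∨ r.1 = m := by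
    intro r hr
    by_contra! hne
    exact hno (key r hr hne.1 hne.2.1 hne.2.2)
  have h5 := cov a ha
  have h6 := cov b hb
  have h7 := cov c hc
  have h8 := cov d hd'
  have n1 : a.1 ≠ b.1 := fun e => hab.ne (Subtype.ext e)
  have n2 : b.1 ≠ c.1 := fun e => hbc.ne (Subtype.ext e)
  have n3 : c.1 ≠ d.1 := fun e => hcd.ne (Subtype.ext e)
  have n4 : d.1 ≠ a.1 := fun e => hda.ne (Subtype.ext e)
  have n5 : a.1 ≠ c.1 := fun e => hac (Subtype.ext e)
  have n6 : b.1 ≠ d.1 := fun e => hbd (Subtype.ext e)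
  grind

end IsSWM

namespace IsSWM

variable {G : SimpleGraph V}

/-! ### Boolean-gated sets and their ranks -/

/-- The Boolean-gated sets of finite diameter. -/
def IsBoolean (G : SimpleGraph V) (X : Set V) : Prop :=
  BooleanGated G X ∧ ∃ D : ℕ, ∀ x ∈ X, ∀ y ∈ X, G.dist x y ≤ D

/-- The largest distance between a vertex of `X` and a vertex of `U`. -/
noncomputable def farDist (G : SimpleGraph V) (X U : Set V) : ℕ :=
  sSup {n | ∃ a ∈ X, ∃ b ∈ U, G.dist a b = n}

/-- The rank (diameter) of a set. -/
noncomputable def rank (G : SimpleGraph V) (X : Set V) : ℕ :=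
  farDist G X X

theorem IsBoolean.gated {X : Set V} (hX : IsBoolean G X) : Gated G X := hX.1.1

theorem IsBoolean.strict (h : IsSWM G) {X : Set V} (hX : IsBoolean G X) {x y : V} (hx : x ∈ X)
    (hy : y ∈ X) : Strict G x y :=
  h.strict_of_thick hX.1.1 hX.1.2 hx hy

theorem IsBoolean.nonempty (h : IsSWM G) {X : Set V} (hX : IsBoolean G X) : X.Nonempty := by
  have := h.conn.nonempty
  obtain ⟨g, hg, -⟩ := hX.gated (Classical.arbitrary V)
  exact ⟨g, hg⟩

theorem IsBoolean.exists_gate {X : Set V} (hX : IsBoolean G X) (x : V) : ∃ g, IsGate G X x g :=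
  hX.gated x

theorem IsBoolean.subset (h : IsSWM G) {X Y : Set V} (hY : IsBoolean G Y) (hX : Gated G X)
    (hXY : X ⊆ Y) : IsBoolean G X := by
  obtain ⟨D, hD⟩ := hY.2
  exact ⟨⟨hX, h.thick_of_strict hX fun a ha b hb => hY.strict h (hXY ha) (hXY hb)⟩,
    D, fun x hx y hy => hD x (hXY hx) y (hXY hy)⟩

theorem isBoolean_hull (h : IsSWM G) {x y : V} (hs : Strict G x y) :
    IsBoolean G (Hull G x y) :=
  ⟨⟨h.gated_hull x y, h.thick_of_strict (h.gated_hull x y)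
    fun _ ha _ hb => h.strict_of_mem_hull hs ha hb⟩,
    G.dist x y, fun _ ha _ hb => h.dist_le_of_mem_hull₂ hs ha hb⟩

theorem bddAbove_farDist (h : IsSWM G) {X U : Set V} (hX : IsBoolean G X)
    (hU : IsBoolean G U) : BddAbove {n | ∃ a ∈ X, ∃ b ∈ U, G.dist a b = n} := by
  obtain ⟨x, hx⟩ := hX.nonempty h
  obtain ⟨u, hu⟩ := hU.nonempty h
  obtain ⟨D, hD⟩ := hX.2
  obtain ⟨D', hD'⟩ := hU.2
  refine ⟨D + G.dist x u + D', ?_⟩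
  rintro n ⟨a, ha, b, hb, rfl⟩
  have h1 := h.tri a x b
  have h2 := h.tri x u b
  have h3 := hD a ha x hx
  have h4 := hD' u hu b hb
  omega

theorem dist_le_farDist (h : IsSWM G) {X U : Set V} (hX : IsBoolean G X) (hU : IsBoolean G U)
    {a b : V} (ha : a ∈ X) (hb : b ∈ U) : G.dist a b ≤ farDist G X U :=
  le_csSup (h.bddAbove_farDist hX hU) ⟨a, ha, b, hb, rfl⟩

theorem exists_farDist (h : IsSWM G) {X U : Set V} (hX : IsBoolean G X) (hU : IsBoolean G U) :
    ∃ a ∈ X, ∃ b ∈ U, G.dist a b = farDist G X U := by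
  obtain ⟨x, hx⟩ := hX.nonempty h
  obtain ⟨u, hu⟩ := hU.nonempty h
  have hne : {n | ∃ a ∈ X, ∃ b ∈ U, G.dist a b = n}.Nonempty := ⟨_, x, hx, u, hu, rfl⟩
  exact Nat.sSup_mem hne (h.bddAbove_farDist hX hU)

theorem dist_le_rank (h : IsSWM G) {X : Set V} (hX : IsBoolean G X) {a b : V} (ha : a ∈ X)
    (hb : b ∈ X) : G.dist a b ≤ rank G X :=
  h.dist_le_farDist hX hX ha hb

theorem rank_hull (h : IsSWM G) {x y : V} (hs : Strict G x y) :
    rank G (Hull G x y) = G.dist x y := by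
  have hB := h.isBoolean_hull hs
  obtain ⟨a, ha, b, hb, hab⟩ := h.exists_farDist hB hB
  refine le_antisymm ?_ (h.dist_le_rank hB (h.left_mem_hull x y) (right_mem_hull hs))
  exact hab.symm.trans_le (h.dist_le_of_mem_hull₂ hs ha hb)

theorem hull_eq_of_dist (h : IsSWM G) {X : Set V} (hX : IsBoolean G X) {x y : V} (hx : x ∈ X)
    (hy : y ∈ X) (hd : G.dist x y = rank G X) : Hull G x y = X := by
  refine Set.Subset.antisymm (h.hull_subset hX.gated hx hy) fun z hz => ?_
  refine ⟨hX.strict h hx hz, fun s hs hsz => ?_⟩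
  rw [hd]
  exact h.dist_le_rank hX (h.near_mem hX.gated hx hz hs hsz) hy

theorem exists_opposite (h : IsSWM G) {X : Set V} (hX : IsBoolean G X) {x : V} (hx : x ∈ X) :
    ∃ y ∈ X, G.dist x y = rank G X := by
  obtain ⟨a, ha, b, hb, hab⟩ := h.exists_farDist hX hX
  have h1 := h.hull_eq_of_dist hX ha hb hab
  obtain ⟨w, h2, h3, h4⟩ := h.exists_hull_eq (hX.strict h ha hb) (u := x) (h1 ▸ hx)
  exact ⟨w, h1 ▸ h4 ▸ right_mem_hull h2, h3.trans hab⟩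

theorem rank_mono (h : IsSWM G) {X Y : Set V} (hX : IsBoolean G X) (hY : IsBoolean G Y)
    (hXY : X ⊆ Y) : rank G X ≤ rank G Y := by
  obtain ⟨a, ha, b, hb, hab⟩ := h.exists_farDist hX hX
  exact hab.symm.trans_le (h.dist_le_rank hY (hXY ha) (hXY hb))

theorem eq_of_rank_le (h : IsSWM G) {X Y : Set V} (hX : IsBoolean G X) (hY : IsBoolean G Y)
    (hXY : X ⊆ Y) (hr : rank G Y ≤ rank G X) : X = Y := by
  obtain ⟨a, ha, b, hb, hab⟩ := h.exists_farDist hX hX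
  rw [← h.hull_eq_of_dist hX ha hb hab]
  exact h.hull_eq_of_dist hY (hXY ha) (hXY hb) (hab.trans (le_antisymm (h.rank_mono hX hY hXY) hr))

theorem isGate_of_adj (h : IsSWM G) {X : Set V} (hX : Gated G X) {x v : V} (hx : x ∈ X)
    (hv : v ∉ X) (hvx : G.Adj v x) : IsGate G X v x := by
  obtain ⟨g, hg, hg'⟩ := hX v
  have h1 := hg' x hx
  rw [dist_of_adj hvx] at h1
  have h2 : G.dist v g ≠ 0 := fun e => hv (h.eq_of_dist e ▸ hg)
  have := h.eq_of_dist (show G.dist g x = 0 by omega)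
  subst this
  exact ⟨hg, hg'⟩

theorem exists_adj_outside (h : IsSWM G) {X Y : Set V} (hX : IsBoolean G X)
    (hY : IsBoolean G Y) (hXY : X ⊂ Y) {x : V} (hx : x ∈ X) : ∃ v ∈ Y, v ∉ X ∧ G.Adj v x := by
  obtain ⟨y, hy, hd⟩ := h.exists_opposite hY (hXY.1 hx)
  by_contra! hno
  refine hXY.2 ?_
  rw [← h.hull_eq_of_dist hY (hXY.1 hx) hy hd]
  refine h.hull_subset_of_near hX.gated hx fun s hs hsy => ?_
  by_contra hsX
  exact hno s (h.near_mem hY.gated (hXY.1 hx) hy hs hsy) hsX hs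

/-- Extending a Boolean-gated set by one dimension. -/
theorem hull_cover (h : IsSWM G) {X : Set V} (hX : IsBoolean G X) {x y v : V} (hx : x ∈ X)
    (hy : y ∈ X) (hd : G.dist x y = rank G X) (hv : v ∉ X) (hvx : G.Adj v x)
    (hs : Strict G y v) :
    IsBoolean G (Hull G y v) ∧ X ⊆ Hull G y v ∧ v ∈ Hull G y v ∧
      rank G (Hull G y v) = rank G X + 1 := by
  have h1 := (h.isGate_of_adj hX.gated hx hv hvx).2 y hy
  rw [dist_of_adj hvx] at h1
  have h2 := right_mem_hull hs
  have h3 := h.left_mem_hull y v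
  refine ⟨h.isBoolean_hull hs, ?_, h2, ?_⟩
  · have h4 : x ∈ Hull G y v := h.gated_convex (h.gated_hull y v) h3 h2
      (by rw [dist_of_adj hvx.symm]; grind [dcomm])
    rw [← h.hull_eq_of_dist hX hx hy hd]
    exact h.hull_subset (h.gated_hull y v) h4 h3
  · rw [h.rank_hull hs]
    grind [dcomm]

theorem exists_cover_through (h : IsSWM G) {X Y : Set V} (hX : IsBoolean G X)
    (hY : IsBoolean G Y) (hXY : X ⊆ Y) {x v : V} (hx : x ∈ X) (hv : v ∈ Y) (hvX : v ∉ X)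
    (hvx : G.Adj v x) :
    ∃ Z, IsBoolean G Z ∧ X ⊆ Z ∧ Z ⊆ Y ∧ v ∈ Z ∧ rank G Z = rank G X + 1 := by
  obtain ⟨y, hy, hd⟩ := h.exists_opposite hX hx
  obtain ⟨h1, h2, h3, h4⟩ := h.hull_cover hX hx hy hd hvX hvx (hY.strict h (hXY hy) hv)
  exact ⟨_, h1, h2, h.hull_subset hY.gated (hXY hy) hv, h3, h4⟩

theorem exists_cover (h : IsSWM G) {X Y : Set V} (hX : IsBoolean G X)
    (hY : IsBoolean G Y) (hXY : X ⊂ Y) :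
    ∃ Z, IsBoolean G Z ∧ X ⊆ Z ∧ Z ⊆ Y ∧ rank G Z = rank G X + 1 := by
  obtain ⟨x, hx⟩ := hX.nonempty h
  obtain ⟨v, hv, hvX, hvx⟩ := h.exists_adj_outside hX hY hXY hx
  obtain ⟨Z, h1, h2, h3, -, h4⟩ := h.exists_cover_through hX hY hXY.1 hx hv hvX hvx
  exact ⟨Z, h1, h2, h3, h4⟩

theorem exists_hyperplane (h : IsSWM G) {X Y : Set V} (hX : IsBoolean G X)
    (hY : IsBoolean G Y) (hXY : X ⊂ Y) :
    ∃ Z, IsBoolean G Z ∧ X ⊆ Z ∧ Z ⊆ Y ∧ rank G Z + 1 = rank G Y := by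
  have key : ∀ n, ∀ X, IsBoolean G X → X ⊂ Y → rank G Y = rank G X + n →
      ∃ Z, IsBoolean G Z ∧ X ⊆ Z ∧ Z ⊆ Y ∧ rank G Z + 1 = rank G Y := by
    intro n
    induction n with
    | zero =>
      intro X hX hXY hr
      exact absurd (h.eq_of_rank_le hX hY hXY.1 (by omega)) hXY.ne
    | succ n ih =>
      intro X hX hXY hr
      obtain ⟨Z, hZ, hXZ, hZY, hrZ⟩ := h.exists_cover hX hY hXY
      by_cases hZY' : Z = Y
      · subst hZY'
        exact ⟨X, hX, subset_rfl, hXZ, hrZ.symm⟩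
      · obtain ⟨W, hW, h1, h2, h3⟩ := ih Z hZ (hZY.ssubset_of_ne hZY') (by omega)
        exact ⟨W, hW, hXZ.trans h1, h2, h3⟩
  have := h.rank_mono hX hY hXY.1
  exact key (rank G Y - rank G X) X hX hXY (by omega)

theorem gate_add_rank_le (h : IsSWM G) {X U : Set V} (hX : IsBoolean G X) (hU : IsBoolean G U)
    {u g : V} (hu : u ∈ U) (hg : IsGate G X u g) : G.dist u g + rank G X ≤ farDist G X U := by
  obtain ⟨y, hy, hd⟩ := h.exists_opposite hX hg.1
  have h1 := hg.2 y hy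
  have h2 := h.dist_le_farDist hX hU hy hu
  grind [dcomm]

theorem gate_add_rank_le_rank (h : IsSWM G) {X Y : Set V} (hX : IsBoolean G X)
    (hY : IsBoolean G Y) (hXY : X ⊆ Y) {u g : V} (hu : u ∈ Y) (hg : IsGate G X u g) :
    G.dist u g + rank G X ≤ rank G Y := by
  obtain ⟨y, hy, hd⟩ := h.exists_opposite hX hg.1
  have h1 := hg.2 y hy
  have h2 := h.dist_le_rank hY hu (hXY hy)
  omega

theorem exists_deep (h : IsSWM G) {B : Set V} (hB : IsBoolean G B) : ∀ n, ∀ A,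
    IsBoolean G A → A ⊆ B → rank G B = rank G A + n → ∀ a ∈ A,
    ∃ b ∈ B, IsGate G A b a ∧ G.dist b a = n := by
  intro n
  induction n with
  | zero =>
    intro A hA hAB hr a ha
    exact ⟨a, hAB ha, isGate_self ha, by simp⟩
  | succ n ih =>
    intro A hA hAB hr a ha
    have hne : A ≠ B := by rintro rfl; omega
    obtain ⟨v, hv, hvA, hva⟩ := h.exists_adj_outside hA hB (hAB.ssubset_of_ne hne) ha
    obtain ⟨Z, hZ, hAZ, hZB, hvZ, hrZ⟩ := h.exists_cover_through hA hB hAB ha hv hvA hva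
    obtain ⟨b, hb, hbv, hbd⟩ := ih Z hZ hZB (by omega) v hvZ
    have h1 := h.isGate_of_adj hA.gated ha hvA hva
    have h2 := hbv.2 a (hAZ ha)
    rw [dist_of_adj hva] at h2
    refine ⟨b, hb, ⟨ha, fun y hy => ?_⟩, by omega⟩
    have h3 := hbv.2 y (hAZ hy)
    have h4 := h1.2 y hy
    rw [dist_of_adj hva] at h4
    omega

/-! ### Mutual projections of gated sets -/

/-- The vertices of `U` at minimum distance from `X`. -/
def foot (G : SimpleGraph V) (U X : Set V) : Set V :=
  {u | u ∈ U ∧ ∃ x ∈ X, ∀ u' ∈ U, ∀ x' ∈ X, G.dist u x ≤ G.dist u' x'}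

theorem exists_min_dist {U X : Set V} (hU : U.Nonempty) (hX : X.Nonempty) :
    ∃ u ∈ U, ∃ x ∈ X, ∀ u' ∈ U, ∀ x' ∈ X, G.dist u x ≤ G.dist u' x' := by
  have hne : {n | ∃ u ∈ U, ∃ x ∈ X, G.dist u x = n}.Nonempty := by
    obtain ⟨u, hu⟩ := hU
    obtain ⟨x, hx⟩ := hX
    exact ⟨_, u, hu, x, hx, rfl⟩
  obtain ⟨u, hu, x, hx, hd⟩ := Nat.sInf_mem hne
  exact ⟨u, hu, x, hx, fun u' hu' x' hx' => hd.trans_le (Nat.sInf_le ⟨u', hu', x', hx', rfl⟩)⟩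

theorem isGate_of_min (h : IsSWM G) {X : Set V} (hX : Gated G X) {u x : V} (hx : x ∈ X)
    (hmin : ∀ x' ∈ X, G.dist u x ≤ G.dist u x') : IsGate G X u x := by
  obtain ⟨g, hg, hg'⟩ := hX u
  have h1 := hg' x hx
  have h2 := hmin g hg
  have := h.eq_of_dist (show G.dist g x = 0 by omega)
  subst this
  exact ⟨hg, hg'⟩

theorem isGate_gate (h : IsSWM G) {X U : Set V} (hX : Gated G X) {u g a : V} (hu : u ∈ U)
    (hg : IsGate G X u g) (ha : IsGate G U g a) : IsGate G X a g := by
  obtain ⟨g', hg1, hg2⟩ := hX a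
  have h1 := hg2 g hg.1
  have h2 := hg.2 g' hg1
  have h3 := ha.2 u hu
  have h4 := h.tri u a g'
  have := h.eq_of_dist (show G.dist g g' = 0 by grind [dcomm])
  subst this
  exact ⟨hg1, hg2⟩

/-- Mutual gates realize the minimum distance and are parallel. -/
theorem mutual_gates {X U : Set V} {a g u₀ x₀ : V}
    (hag : IsGate G X a g) (hga : IsGate G U g a) (h0 : IsGate G X u₀ x₀)
    (h0' : IsGate G U x₀ u₀) :
    G.dist a g = G.dist u₀ x₀ ∧ G.dist g x₀ = G.dist a u₀ := by
  have h1 := hag.2 x₀ h0.1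
  have h2 := hga.2 u₀ h0'.1
  have h3 := h0.2 g hag.1
  have h4 := h0'.2 a hga.1
  grind [dcomm]

theorem isGate_foot (h : IsSWM G) {X U : Set V} (hX : Gated G X) (hU : Gated G U) {u g a : V}
    (hu : u ∈ U) (hg : IsGate G X u g) (ha : IsGate G U g a) :
    IsGate G (foot G U X) u a ∧ (∀ u' ∈ U, ∀ x' ∈ X, G.dist a g ≤ G.dist u' x') := by
  have hag := h.isGate_gate hX hu hg ha
  have par : ∀ u₀ ∈ U, ∀ x₀ ∈ X, (∀ u' ∈ U, ∀ x' ∈ X, G.dist u₀ x₀ ≤ G.dist u' x') →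
      G.dist a g = G.dist u₀ x₀ ∧ G.dist g x₀ = G.dist a u₀ := by
    intro u₀ hu₀ x₀ hx₀ hmin
    refine mutual_gates hag ha (h.isGate_of_min hX hx₀ fun x' hx' => hmin u₀ hu₀ x' hx')
      (h.isGate_of_min hU hu₀ fun u' hu' => ?_)
    rw [dcomm G x₀ u₀, dcomm G x₀ u']
    exact hmin u' hu' x₀ hx₀
  have hmin : ∀ u' ∈ U, ∀ x' ∈ X, G.dist a g ≤ G.dist u' x' := by
    obtain ⟨u₀, hu₀, x₀, hx₀, hmin⟩ := exists_min_dist (G := G) ⟨u, hu⟩ ⟨g, hg.1⟩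
    rw [(par u₀ hu₀ x₀ hx₀ hmin).1]
    exact hmin
  refine ⟨⟨⟨ha.1, g, hg.1, hmin⟩, ?_⟩, hmin⟩
  rintro u' ⟨hu', x', hx', hmin'⟩
  obtain ⟨h1, h2⟩ := par u' hu' x' hx' hmin'
  have h3 := hg.2 x' hx'
  have h4 := ha.2 u hu
  have h5 := h.tri u u' x'
  have h6 := h.tri u a u'
  grind [dcomm]

theorem gated_foot (h : IsSWM G) {X U : Set V} (hX : Gated G X) (hU : Gated G U) :
    Gated G (foot G U X) := by
  intro p
  obtain ⟨u, hu, hu'⟩ := hU p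
  obtain ⟨g, hg⟩ : ∃ g, IsGate G X u g := hX u
  obtain ⟨a, ha⟩ : ∃ a, IsGate G U g a := hU g
  obtain ⟨⟨h1, h2⟩, -⟩ := h.isGate_foot hX hU hu hg ha
  refine ⟨a, h1, fun y hy => ?_⟩
  rw [hu' y hy.1, h2 y hy, hu' a ha.1]
  omega

/-- Every gate in `X` of a vertex of `U` is the gate of a vertex of `U` as far as possible from
`X`. -/
theorem exists_far (h : IsSWM G) {X U : Set V} (hX : IsBoolean G X) (hU : IsBoolean G U)
    {u g : V} (hu : u ∈ U) (hg : IsGate G X u g) :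
    ∃ v ∈ U, IsGate G X v g ∧ G.dist v g + rank G X = farDist G X U := by
  have hF : IsBoolean G (foot G U X) :=
    hU.subset h (h.gated_foot hX.gated hU.gated) fun _ hx => hx.1
  have hFU : foot G U X ⊆ U := fun _ hx => hx.1
  obtain ⟨a, ha⟩ := hU.exists_gate g
  obtain ⟨h1, h2⟩ := h.isGate_foot hX.gated hU.gated hu hg ha
  have hr := h.rank_mono hF hU hFU
  obtain ⟨b, hb, hba, hbd⟩ := h.exists_deep hU (rank G U - rank G (foot G U X)) _ hF hFU
    (by omega) a h1.1
  have key : ∀ v ∈ U, ∀ g', IsGate G X v g' → ∃ a', IsGate G U g' a' ∧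
      IsGate G (foot G U X) v a' ∧ G.dist v g' = G.dist v a' + G.dist a g := by
    intro v hv g' hg'
    obtain ⟨a', ha'⟩ := hU.exists_gate g'
    obtain ⟨h3, h4⟩ := h.isGate_foot hX.gated hU.gated hv hg' ha'
    refine ⟨a', ha', h3, ?_⟩
    have h5 := ha'.2 v hv
    have h6 := h2 a' ha'.1 g' hg'.1
    have h7 := h4 a ha.1 g hg.1
    grind [dcomm]
  obtain ⟨g', hg'⟩ := hX.exists_gate b
  obtain ⟨a', ha', h3, h4⟩ := key b hb g' hg'
  have := IsGate.unique h hba h3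
  subst this
  have hgg' := IsGate.unique h (h.isGate_gate hX.gated hu hg ha)
    (h.isGate_gate hX.gated hb hg' ha')
  subst hgg'
  refine ⟨b, hb, hg', le_antisymm (h.gate_add_rank_le hX hU hb hg') ?_⟩
  obtain ⟨x, hx, y, hy, hxy⟩ := h.exists_farDist hX hU
  obtain ⟨g', hgy⟩ := hX.exists_gate y
  obtain ⟨a', -, h5, h6⟩ := key y hy g' hgy
  have h7 := hgy.2 x hx
  have h8 := h.dist_le_rank hX hgy.1 hx
  have h9 := h.gate_add_rank_le_rank hF hU hFU hy h5
  rw [← hxy, dcomm G x y]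
  omega

/-- If all gates of `U` in `Y` that belong to the farthest vertices of `U` lie in `X`, then all
gates do. -/
theorem gate_mem_of_far (h : IsSWM G) {Y U X : Set V} (hY : IsBoolean G Y) (hU : IsBoolean G U)
    (hfar : ∀ v ∈ U, ∀ g, IsGate G Y v g → G.dist v g + rank G Y = farDist G Y U → g ∈ X)
    {u g : V} (hu : u ∈ U) (hg : IsGate G Y u g) : g ∈ X := by
  obtain ⟨v, hv, h1, h2⟩ := h.exists_far hY hU hu hg
  exact hfar v hv g h1 h2

theorem farDist_mono (h : IsSWM G) {X Y U : Set V} (hX : IsBoolean G X) (hY : IsBoolean G Y)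
    (hU : IsBoolean G U) (hXY : X ⊆ Y) : farDist G X U ≤ farDist G Y U := by
  obtain ⟨a, ha, b, hb, hab⟩ := h.exists_farDist hX hU
  exact hab.symm.trans_le (h.dist_le_farDist hY hU (hXY ha) hb)

theorem farDist_le_add_one (h : IsSWM G) {X Y U : Set V} (hX : IsBoolean G X)
    (hY : IsBoolean G Y) (hU : IsBoolean G U) (hXY : X ⊆ Y) (hr : rank G Y = rank G X + 1) :
    farDist G Y U ≤ farDist G X U + 1 := by
  obtain ⟨a, ha, b, hb, hab⟩ := h.exists_farDist hY hU
  obtain ⟨g, hg⟩ := hX.exists_gate a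
  have h1 := h.gate_add_rank_le_rank hX hY hXY ha hg
  have h2 := h.dist_le_farDist hX hU hg.1 hb
  have h3 := h.tri a g b
  omega

theorem rank_inter (h : IsSWM G) {X Y Z : Set V} (hX : IsBoolean G X) (hY : IsBoolean G Y)
    (hZ : IsBoolean G Z) (hXZ : X ⊆ Z) (hYZ : Y ⊆ Z) (hrX : rank G X + 1 = rank G Z)
    (hrY : rank G Y + 1 = rank G Z) (hne : X ≠ Y) (hI : (X ∩ Y).Nonempty) :
    IsBoolean G (X ∩ Y) ∧ rank G (X ∩ Y) + 1 = rank G X := by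
  have hB : IsBoolean G (X ∩ Y) :=
    hX.subset h (h.gated_inter hX.gated hY.gated hI) Set.inter_subset_left
  refine ⟨hB, ?_⟩
  have hle := h.rank_mono hB hX Set.inter_subset_left
  have hlt : rank G (X ∩ Y) ≠ rank G X := by
    intro e
    have h1 := h.eq_of_rank_le hB hX Set.inter_subset_left (by omega)
    have h2 : X ⊆ Y := fun z hz => (h1.symm ▸ hz : z ∈ X ∩ Y).2
    exact hne (h.eq_of_rank_le hX hY h2 (by omega))
  obtain ⟨a, ha⟩ := hI
  obtain ⟨v, hv, hva, hd⟩ := h.exists_deep hX (rank G X - rank G (X ∩ Y)) _ hB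
    Set.inter_subset_left (by omega) a ha
  obtain ⟨w, hw⟩ := hY.exists_gate v
  have h1 := h.gate_add_rank_le_rank hY hZ hYZ (hXZ hv) hw
  have h2 := hw.2 a ha.2
  have h3 : w ∈ X ∩ Y := ⟨h.gated_convex hX.gated hv ha.1 h2.symm, hw.1⟩
  have h4 := hva.2 w h3
  omega

end IsSWM

/-! ### Graph-theoretic criteria -/

/-- A function that can always be decreased along an edge, and never faster than by one, is the
distance function. -/
theorem connected_and_dist_eq {W : Type*} [Nonempty W] {H : SimpleGraph W} {f : W → W → ℕ}
    (hself : ∀ u, f u u = 0) (hlip : ∀ u x y, H.Adj x y → f x u ≤ f y u + 1)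
    (hmove : ∀ u x, x ≠ u → ∃ y, H.Adj x y ∧ f y u + 1 = f x u) :
    H.Connected ∧ ∀ x u, H.dist x u = f x u := by
  have hle : ∀ (u x : W) (p : H.Walk x u), f x u ≤ p.length := by
    intro u x p
    induction p with
    | nil => simp [hself]
    | @cons _ _ u e p ih =>
      have := hlip u _ _ e
      rw [SimpleGraph.Walk.length_cons]
      omega
  have hwalk : ∀ n, ∀ u x : W, f x u = n → ∃ p : H.Walk x u, p.length = n := by
    intro n
    induction n with
    | zero =>
      intro u x e
      by_cases hxu : x = u
      · subst hxu
        exact ⟨.nil, rfl⟩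
      · obtain ⟨y, -, hy⟩ := hmove u x hxu
        omega
    | succ n ih =>
      intro u x e
      by_cases hxu : x = u
      · subst hxu
        rw [hself] at e
        omega
      · obtain ⟨y, hxy, hy⟩ := hmove u x hxu
        obtain ⟨p, hp⟩ := ih u y (by omega)
        exact ⟨.cons hxy p, by simp [hp]⟩
  have hconn : H.Connected := ⟨fun x u => (hwalk _ u x rfl).choose.reachable⟩
  refine ⟨hconn, fun x u => le_antisymm ?_ ?_⟩
  · obtain ⟨p, hp⟩ := hwalk _ u x rfl
    exact hp ▸ SimpleGraph.dist_le p
  · obtain ⟨p, hp⟩ := hconn.exists_walk_length_eq_dist x u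
    exact hp ▸ hle u x p

theorem isModularGraph_of_quadrangle {W : Type*} {H : SimpleGraph W} (hc : H.Connected)
    (hbip : ∀ u x y, H.Adj x y → H.dist x u ≠ H.dist y u)
    (hquad : ∀ u z v w, H.Adj z v → H.Adj z w → v ≠ w → H.dist v u + 1 = H.dist z u →
      H.dist w u + 1 = H.dist z u →
      ∃ x, H.Adj v x ∧ H.Adj w x ∧ H.dist x u + 1 = H.dist v u) :
    IsModularGraph H := by
  have hadj : ∀ u x y, H.Adj x y → H.dist x u ≤ H.dist y u + 1 := by
    intro u x y e
    have := hc.dist_triangle (u := x) (v := y) (w := u)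
    rw [SimpleGraph.dist_eq_one_iff_adj.2 e] at this
    omega
  have step : ∀ n, ∀ u v w, H.dist v w = n → H.dist u w < H.dist v u + n →
      ∃ v', H.Adj v v' ∧ H.dist v' w + 1 = n ∧ H.dist v' u + 1 = H.dist v u := by
    intro n
    induction n with
    | zero =>
      intro u v w hn hlt
      have := hc.dist_eq_zero_iff.1 hn
      subst this
      rw [IsSWM.dcomm H] at hlt
      omega
    | succ n ih =>
      intro u v w hn hlt
      obtain ⟨p, hp⟩ := hc.exists_walk_length_eq_dist v w
      cases p with
      | nil => simp at hn
      | @cons _ v₁ _ e p =>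
        have h1 := SimpleGraph.dist_le p
        have h2 := hadj w v v₁ e
        rw [SimpleGraph.Walk.length_cons] at hp
        have h3 := hadj u v v₁ e
        have h4 := hadj u v₁ v e.symm
        have h5 := hbip u v v₁ e
        by_cases hcl : H.dist v₁ u + 1 = H.dist v u
        · exact ⟨v₁, e, by omega, hcl⟩
        · obtain ⟨v₂, e₂, h6, h7⟩ := ih u v₁ w (by omega) (by omega)
          have hne : v ≠ v₂ := by
            rintro rfl
            omega
          obtain ⟨x, hvx, hx, h8⟩ := hquad u v₁ v v₂ e.symm e₂ hne (by omega) h7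
          have h9 := hadj w x v₂ hx.symm
          have h10 := hadj w v x hvx
          exact ⟨x, hvx, by omega, h8⟩
  refine ⟨hc, fun u v w => ?_⟩
  have key : ∀ n, ∀ v, H.dist v u = n → ∃ m, m ∈ gInterval H u v ∧ m ∈ gInterval H v w ∧
      m ∈ gInterval H w u := by
    intro n
    induction n with
    | zero =>
      intro v hn
      have := hc.dist_eq_zero_iff.1 hn
      subst this
      exact ⟨v, by simp [gInterval], by simp [gInterval], by simp [gInterval]⟩
    | succ n ih =>
      intro v hn
      by_cases hv : H.dist u w < H.dist v u + H.dist v w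
      · obtain ⟨v', e, h1, h2⟩ := step _ u v w rfl hv
        obtain ⟨m, hm1, hm2, hm3⟩ := ih v' (by omega)
        refine ⟨m, ?_, ?_, hm3⟩ <;> simp only [gInterval, Set.mem_ofPred_eq] at hm1 hm2 ⊢
        · have h3 := hc.dist_triangle (u := u) (v := m) (w := v)
          have h4 := hadj m v v' e
          rw [IsSWM.dcomm H m v] at h3 ⊢
          rw [IsSWM.dcomm H u v] at h3 ⊢
          rw [IsSWM.dcomm H m v', IsSWM.dcomm H u v'] at hm1
          omega
        · have h3 := hc.dist_triangle (u := v) (v := m) (w := w)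
          have h4 := hadj m v v' e
          omega
      · have h1 := hc.dist_triangle (u := u) (v := v) (w := w)
        rw [IsSWM.dcomm H u v] at h1
        refine ⟨v, by simp [gInterval], by simp [gInterval], ?_⟩
        simp only [gInterval, Set.mem_ofPred_eq]
        rw [IsSWM.dcomm H w v, IsSWM.dcomm H w u]
        omega
  exact key _ v rfl

namespace IsSWM

variable {G : SimpleGraph V}

/-! ### Covers and the farthest distance -/

theorem IsGate.of_subset {X Y : Set V} {u g : V} (hXY : X ⊆ Y) (hg : IsGate G Y u g) (hgX : g ∈ X) :
    IsGate G X u g :=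
  ⟨hgX, fun y hy => hg.2 y (hXY hy)⟩

/-- Vertices outside `X` of a Boolean-gated set covering `X` are adjacent to their gates in `X`. -/
theorem exists_gate_adj (h : IsSWM G) {X Y : Set V} (hX : IsBoolean G X) (hY : IsBoolean G Y)
    (hXY : X ⊆ Y) (hr : rank G Y = rank G X + 1) {u g : V} (hg : IsGate G Y u g) (hgX : g ∉ X) :
    ∃ a, G.Adj g a ∧ IsGate G X g a ∧ IsGate G X u a ∧ G.dist u a = G.dist u g + 1 := by
  obtain ⟨a, ha⟩ := hX.exists_gate g
  have h1 := h.gate_add_rank_le_rank hX hY hXY hg.1 ha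
  have h2 : G.dist g a ≠ 0 := fun e => hgX (h.eq_of_dist e ▸ ha.1)
  have h3 : G.dist g a = 1 := by omega
  have h4 : G.dist u a = G.dist u g + 1 := by rw [hg.2 a (hXY ha.1), h3]
  refine ⟨a, adj_of_dist h3, ha, ⟨ha.1, fun y hy => ?_⟩, h4⟩
  have h5 := hg.2 y (hXY hy)
  have h6 := ha.2 y hy
  omega

theorem farDist_eq_of_gate_notMem (h : IsSWM G) {X Y U : Set V} (hX : IsBoolean G X)
    (hY : IsBoolean G Y) (hU : IsBoolean G U) (hXY : X ⊆ Y) (hr : rank G Y = rank G X + 1)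
    {u g : V} (hu : u ∈ U) (hg : IsGate G Y u g) (hgX : g ∉ X) :
    farDist G Y U = farDist G X U := by
  by_contra hne
  have h1 := h.farDist_mono hX hY hU hXY
  refine hgX (h.gate_mem_of_far hY hU (fun v hv g' hg' hd => ?_) hu hg)
  by_contra hgX'
  obtain ⟨a, -, -, ha, hda⟩ := h.exists_gate_adj hX hY hXY hr hg' hgX'
  have h2 := h.gate_add_rank_le hX hU hv ha
  omega

theorem farDist_eq_add_one (h : IsSWM G) {X Y U : Set V} (hX : IsBoolean G X)
    (hY : IsBoolean G Y) (hU : IsBoolean G U) (hXY : X ⊆ Y) (hr : rank G Y = rank G X + 1)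
    (hgate : ∀ u ∈ U, ∀ g, IsGate G Y u g → g ∈ X) :
    farDist G Y U = farDist G X U + 1 := by
  refine le_antisymm (h.farDist_le_add_one hX hY hU hXY hr) ?_
  obtain ⟨a, ha, b, hb, hab⟩ := h.exists_farDist hX hU
  obtain ⟨g, hg⟩ := hY.exists_gate b
  have h1 := h.gate_add_rank_le hY hU hb hg
  have h2 := hg.2 a (hXY ha)
  have h3 := h.dist_le_rank hX (hgate b hb g hg) ha
  rw [dcomm G a b] at hab
  omega

/-- A vertex adjacent to `X` and closer than `X` to a set `U` parallel to `X` spans a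
Boolean-gated set with every vertex of `X`. -/
theorem strict_of_parallel (h : IsSWM G) {X U : Set V} (hX : IsBoolean G X) (hU : IsBoolean G U)
    {d : ℕ} (hd : ∀ x ∈ X, ∀ u, IsGate G U x u → G.dist x u = d)
    (hle : ∀ x ∈ X, ∀ u ∈ U, d ≤ G.dist x u) :
    ∀ n, ∀ y ∈ X, ∀ x ∈ X, G.dist y x = n → ∀ x' v, IsGate G U x x' → G.Adj v x →
      G.dist v x' + 1 = d → Strict G y v := by
  have hnot : ∀ u ∈ U, ∀ v, G.dist v u + 1 = d → v ∉ X := fun u hu v hv hvX => by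
    have := hle v hvX u hu
    omega
  intro n
  induction n with
  | zero =>
    intro y hy x hx hn x' v hx' hvx hv
    have := h.eq_of_dist hn
    subst this
    exact h.strict_of_le_one (by rw [dcomm, dist_of_adj hvx])
  | succ n ih =>
    intro y hy x hx hn x' v hx' hvx hv
    have hyx : y ≠ x := by
      rintro rfl
      simp at hn
    obtain ⟨s, hsx, hs⟩ := h.exists_toward hyx
    have hsX : s ∈ X := h.gated_convex hX.gated hy hx (by rw [dist_of_adj hsx]; exact hs)
    obtain ⟨s', hs'⟩ := hU.exists_gate s
    have gate : ∀ t ∈ X, ∀ t', IsGate G U t t' → IsGate G X t' t := fun t ht t' ht' =>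
      h.isGate_of_min hX.gated ht fun t₁ ht₁ => by
        rw [dcomm G t' t, hd t ht t' ht', dcomm G t' t₁]
        exact hle t₁ ht₁ t' ht'.1
    have e1 := hd x hx x' hx'
    have e2 := hd s hsX s' hs'
    have e3 := hx'.2 s' hs'.1
    have e4 := (gate s hsX s' hs').2 x hx
    have e5 : G.dist x' s' = 1 := by
      rw [dist_of_adj hsx, dcomm G s' x, dcomm G s' s] at e4
      omega
    have e6 := h.tri v x' s'
    have e7 := (h.adj_le hvx s').2
    have e8 := (h.adj_le hvx s').1
    have hvX := hnot x' hx'.1 v hv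
    obtain ⟨-, s₁, hs₁s, hs₁v, hs₁⟩ := h.QC (u := s') hsx.symm hvx.symm
      (fun e => hvX (e ▸ hsX)) (by grind [dcomm]) (by grind [dcomm])
    have hs₁X := hnot s' hs'.1 s₁ (by grind [dcomm])
    have st := ih y hy s hsX (by omega) s' s₁ hs' hs₁s.symm (by grind [dcomm])
    have f1 := (h.isGate_of_adj hX.gated hsX hs₁X hs₁s.symm).2 y hy
    have f2 := (h.isGate_of_adj hX.gated hx hvX hvx).2 y hy
    rw [dist_of_adj hs₁s.symm] at f1
    rw [dist_of_adj hvx] at f2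
    exact h.strict_of_two v x s₁ hvx hs₁v (fun e => hs₁X (e ▸ hx)) (by grind [dcomm])
      (by grind [dcomm]) (hX.strict h hy hx) st

/-- The relation that `Y` covers `X`, between Boolean-gated sets. -/
def Cov (G : SimpleGraph V) (X Y : Set V) : Prop :=
  X ⊆ Y ∧ rank G Y = rank G X + 1

theorem exists_closer (h : IsSWM G) {X U : Set V} (hX : IsBoolean G X) (hU : IsBoolean G U)
    (hne : X ≠ U) :
    ∃ Y, IsBoolean G Y ∧ (Cov G Y X ∧ farDist G X U = farDist G Y U + 1 ∨
      Cov G X Y ∧ farDist G Y U = farDist G X U) := by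
  have hFX : foot G X U ⊆ X := fun _ hx => hx.1
  have hfoot : ∀ u ∈ U, ∀ g, IsGate G X u g → g ∈ foot G X U := by
    intro u hu g hg
    obtain ⟨a, ha⟩ := hU.exists_gate g
    obtain ⟨-, h2⟩ := h.isGate_foot hX.gated hU.gated hu hg ha
    refine ⟨hg.1, a, ha.1, fun x' hx' u' hu' => ?_⟩
    rw [dcomm G g a, dcomm G x' u']
    exact h2 u' hu' x' hx'
  by_cases hF : foot G X U = X
  · obtain ⟨x, hx⟩ := hX.nonempty h
    obtain ⟨x', hx'⟩ := hU.exists_gate x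
    have hmin : ∀ x ∈ X, ∀ u, IsGate G U x u → ∀ x₁ ∈ X, ∀ u₁ ∈ U,
        G.dist x u ≤ G.dist x₁ u₁ := by
      intro x hx u hu x₁ hx₁ u₁ hu₁
      rw [← hF] at hx
      obtain ⟨-, u₂, hu₂, hm⟩ := hx
      have h1 := hu.2 u₂ hu₂
      have h2 := hm x₁ hx₁ u₁ hu₁
      omega
    by_cases h0 : G.dist x x' = 0
    · have hXU : X ⊆ U := by
        intro y hy
        obtain ⟨y', hy'⟩ := hU.exists_gate y
        have h1 := hmin y hy y' hy' x hx x' hx'.1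
        have h2 := h.eq_of_dist (show G.dist y y' = 0 by omega)
        exact h2 ▸ hy'.1
      obtain ⟨Y, hY, hXY, hYU, hr⟩ := h.exists_cover hX hU (hXU.ssubset_of_ne hne)
      refine ⟨Y, hY, .inr ⟨⟨hXY, hr⟩, ?_⟩⟩
      obtain ⟨y, hy, hyX⟩ : ∃ y ∈ Y, y ∉ X := by
        by_contra! hc
        have := h.rank_mono hY hX hc
        omega
      exact h.farDist_eq_of_gate_notMem hX hY hU hXY hr (hYU hy) (isGate_self hy) hyX
    · obtain ⟨x₁, hx₁, hxx₁⟩ := h.exists_opposite hX hx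
      have hxx' : x' ≠ x := by
        rintro rfl
        simp at h0
      obtain ⟨v, hvx, hv⟩ := h.exists_toward hxx'
      have hst := h.strict_of_parallel hX hU
        (fun y hy u hu => le_antisymm (hmin y hy u hu x hx x' hx'.1)
          (hmin x hx x' hx' y hy u hu.1))
        (fun y hy u hu => hmin x hx x' hx' y hy u hu) _ x₁ hx₁ x hx rfl x' v hx' hvx
        (by grind [dcomm])
      have hvX : v ∉ X := fun hvX => by
        have := hmin x hx x' hx' v hvX x' hx'.1
        grind [dcomm]
      obtain ⟨hB, hXB, hvB, hr⟩ := h.hull_cover hX hx hx₁ hxx₁ hvX hvx hst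
      refine ⟨_, hB, .inr ⟨⟨hXB, hr⟩, ?_⟩⟩
      obtain ⟨g, hg⟩ := hB.exists_gate x'
      refine h.farDist_eq_of_gate_notMem hX hB hU hXB hr hx'.1 hg fun hgX => ?_
      have h1 := hmin x hx x' hx' g hgX x' hx'.1
      have h2 := hg.2 v hvB
      grind [dcomm]
  · have hFB := hX.subset h (h.gated_foot hU.gated hX.gated) hFX
    obtain ⟨Y, hY, hFY, hYX, hr⟩ := h.exists_hyperplane hFB hX (hFX.ssubset_of_ne hF)
    exact ⟨Y, hY, .inl ⟨⟨hYX, hr.symm⟩, h.farDist_eq_add_one hY hX hU hYX hr.symm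
      fun u hu g hg => hFY (hfoot u hu g hg)⟩⟩

/-! ### The quadrangle condition for Boolean-gated sets -/

theorem gate_mem_of_farDist_ne (h : IsSWM G) {X Y U : Set V} (hX : IsBoolean G X)
    (hY : IsBoolean G Y) (hU : IsBoolean G U) (hXY : Cov G X Y)
    (hM : farDist G Y U ≠ farDist G X U) {u g : V} (hu : u ∈ U) (hg : IsGate G Y u g) :
    g ∈ X := by
  by_contra hgX
  exact hM (h.farDist_eq_of_gate_notMem hX hY hU hXY.1 hXY.2 hu hg hgX)

theorem quad_down (h : IsSWM G) {U Z A B : Set V} (hU : IsBoolean G U) (hZ : IsBoolean G Z)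
    (hA : IsBoolean G A) (hB : IsBoolean G B) (hAZ : Cov G A Z) (hBZ : Cov G B Z) (hne : A ≠ B)
    (hMA : farDist G Z U = farDist G A U + 1) (hMB : farDist G Z U = farDist G B U + 1) :
    ∃ X, IsBoolean G X ∧ Cov G X A ∧ Cov G X B ∧ farDist G A U = farDist G X U + 1 := by
  have hmem : ∀ u ∈ U, ∀ g, IsGate G Z u g → g ∈ A ∩ B := fun u hu g hg =>
    ⟨h.gate_mem_of_farDist_ne hA hZ hU hAZ (by omega) hu hg,
      h.gate_mem_of_farDist_ne hB hZ hU hBZ (by omega) hu hg⟩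
  obtain ⟨u, hu⟩ := hU.nonempty h
  obtain ⟨g, hg⟩ := hZ.exists_gate u
  obtain ⟨hX, hr⟩ := h.rank_inter hA hB hZ hAZ.1 hBZ.1 hAZ.2.symm hBZ.2.symm hne
    ⟨g, hmem u hu g hg⟩
  have hrA := hAZ.2
  have hrB := hBZ.2
  refine ⟨_, hX, ⟨Set.inter_subset_left, hr.symm⟩, ⟨Set.inter_subset_right, by omega⟩,
    h.farDist_eq_add_one hX hA hU Set.inter_subset_left hr.symm fun u hu g hg => ?_⟩
  obtain ⟨g', hg'⟩ := hZ.exists_gate u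
  have h1 := hmem u hu g' hg'
  exact IsGate.unique h hg (hg'.of_subset hAZ.1 h1.1) ▸ h1

theorem quad_middle (h : IsSWM G) {U Z A B : Set V} (hU : IsBoolean G U) (hZ : IsBoolean G Z)
    (hA : IsBoolean G A) (hB : IsBoolean G B) (hAZ : Cov G A Z) (hZB : Cov G Z B)
    (hMA : farDist G Z U = farDist G A U + 1) (hMB : farDist G B U = farDist G Z U) :
    ∃ X, IsBoolean G X ∧ Cov G A X ∧ Cov G X B ∧ farDist G X U = farDist G A U := by
  obtain ⟨u, hu, w, hw, hwZ⟩ : ∃ u ∈ U, ∃ w, IsGate G B u w ∧ w ∉ Z := by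
    by_contra! hc
    have := h.farDist_eq_add_one hZ hB hU hZB.1 hZB.2 hc
    omega
  obtain ⟨v, hwv, hwv', huv, -⟩ := h.exists_gate_adj hZ hB hZB.1 hZB.2 hw hwZ
  have hvA := h.gate_mem_of_farDist_ne hA hZ hU hAZ (by omega) hu huv
  obtain ⟨v₁, hv₁, hd⟩ := h.exists_opposite hA hvA
  have hwA : w ∉ A := fun hwA => hwZ (hAZ.1 hwA)
  have hv₁B := hZB.1 (hAZ.1 hv₁)
  obtain ⟨hX, hAX, hwX, hr⟩ := h.hull_cover hA hvA hv₁ hd hwA hwv (hB.strict h hv₁B hw.1)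
  have hXB := h.hull_subset hB.gated hv₁B hw.1
  have h1 := hAZ.2
  have h2 := hZB.2
  exact ⟨_, hX, ⟨hAX, hr⟩, ⟨hXB, by omega⟩, h.farDist_eq_of_gate_notMem hA hX hU hAX hr hu
    (hw.of_subset hXB hwX) hwA⟩

theorem quad_up (h : IsSWM G) {U Z A B : Set V} (hU : IsBoolean G U) (hZ : IsBoolean G Z)
    (hA : IsBoolean G A) (hB : IsBoolean G B) (hZA : Cov G Z A) (hZB : Cov G Z B) (hne : A ≠ B)
    (hMA : farDist G A U = farDist G Z U) (hMB : farDist G B U = farDist G Z U) :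
    ∃ X, IsBoolean G X ∧ Cov G A X ∧ Cov G B X ∧ farDist G X U = farDist G A U := by
  obtain ⟨u₀, hu₀⟩ := hU.nonempty h
  obtain ⟨z₀, hz₀⟩ := hZ.exists_gate u₀
  obtain ⟨u, hu, hz, hfar⟩ := h.exists_far hZ hU hu₀ hz₀
  generalize z₀ = z at hz hfar
  have side : ∀ A, IsBoolean G A → Cov G Z A → farDist G A U = farDist G Z U →
      ∃ v, IsGate G A u v ∧ v ∉ Z ∧ G.Adj v z ∧ IsGate G Z v z ∧
        G.dist u z = G.dist u v + 1 := by
    intro A hA hZA hM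
    obtain ⟨v, hv⟩ := hA.exists_gate u
    have hvZ : v ∉ Z := fun hvZ => by
      have := IsGate.unique h hz (hv.of_subset hZA.1 hvZ)
      subst this
      have h1 := h.gate_add_rank_le hA hU hu hv
      have h2 := hZA.2
      omega
    obtain ⟨a, h1, h2, h3, h4⟩ := h.exists_gate_adj hZ hA hZA.1 hZA.2 hv hvZ
    have := IsGate.unique h hz h3
    subst this
    exact ⟨v, hv, hvZ, h1, h2, h4⟩
  obtain ⟨v, hv, hvZ, hvz, hvz', hdv⟩ := side A hA hZA hMA
  obtain ⟨w, hw, hwZ, hwz, hwz', hdw⟩ := side B hB hZB hMB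
  obtain ⟨z₁, hz₁, hzz₁⟩ := h.exists_opposite hZ hz.1
  have hrA := hZA.2
  have hrB := hZB.2
  have dv := hvz'.2 z₁ hz₁
  have dw := hwz'.2 z₁ hz₁
  rw [dist_of_adj hvz] at dv
  rw [dist_of_adj hwz] at dw
  have hullA := h.hull_eq_of_dist hA (hZA.1 hz₁) hv.1 (by grind [dcomm])
  have hullB := h.hull_eq_of_dist hB (hZB.1 hz₁) hw.1 (by grind [dcomm])
  have hvw : v ≠ w := by
    rintro rfl
    exact hne (hullA.symm.trans hullB)
  obtain ⟨-, x, hvx, hwx, hx⟩ := h.QC (u := u) hvz.symm hwz.symm hvw (by omega) (by omega)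
  have hxA : x ∉ A := fun hxA => by
    have := hv.2 x hxA
    omega
  have hxB : x ∉ B := fun hxB => by
    have := hw.2 x hxB
    omega
  have dx := (h.isGate_of_adj hA.gated hv.1 hxA hvx.symm).2 z₁ (hZA.1 hz₁)
  rw [dist_of_adj hvx.symm] at dx
  have hst : Strict G z₁ x := h.strict_of_two x v w hvx.symm hwx.symm hvw (by grind [dcomm])
    (by grind [dcomm]) (hA.strict h (hZA.1 hz₁) hv.1) (hB.strict h (hZB.1 hz₁) hw.1)
  have hX := h.isBoolean_hull hst
  have hz₁X := h.left_mem_hull z₁ x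
  have hxX := right_mem_hull hst
  have hrX := h.rank_hull hst
  have hAX : A ⊆ Hull G z₁ x := by
    rw [← hullA]
    exact h.hull_subset hX.gated hz₁X (h.gated_convex hX.gated hz₁X hxX
      (by rw [dist_of_adj hvx]; grind [dcomm]))
  have hBX : B ⊆ Hull G z₁ x := by
    rw [← hullB]
    exact h.hull_subset hX.gated hz₁X (h.gated_convex hX.gated hz₁X hxX
      (by rw [dist_of_adj hwx]; grind [dcomm]))
  have hrAX : rank G (Hull G z₁ x) = rank G A + 1 := by grind [dcomm]
  obtain ⟨t, ht⟩ := hX.exists_gate u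
  refine ⟨_, hX, ⟨hAX, hrAX⟩, ⟨hBX, by omega⟩,
    h.farDist_eq_of_gate_notMem hA hX hU hAX hrAX hu ht fun htA => ?_⟩
  have h1 := hv.2 t htA
  have h2 := ht.2 x hxX
  omega

end IsSWM

namespace IsSWM

variable {G : SimpleGraph V}

/-! ### The barycentric graph -/

theorem cov_iff (h : IsSWM G) (X Y : BSet G) :
    (X.1 ⊂ Y.1 ∧ ¬ ∃ Z : BSet G, X.1 ⊂ Z.1 ∧ Z.1 ⊂ Y.1) ↔ Cov G X.1 Y.1 := by
  have hlt : ∀ {A B : Set V}, IsBoolean G A → IsBoolean G B → A ⊂ B → rank G A < rank G B := by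
    intro A B hA hB hAB
    by_contra hc
    exact hAB.ne (h.eq_of_rank_le hA hB hAB.1 (by omega))
  constructor
  · rintro ⟨h1, h2⟩
    obtain ⟨Z, hZ, hXZ, hZY, hr⟩ := h.exists_cover X.2 Y.2 h1
    have hXZ' : X.1 ≠ Z := by
      rintro rfl
      omega
    by_cases hZ' : Z = Y.1
    · subst hZ'
      exact ⟨hXZ, hr⟩
    · exact absurd ⟨⟨Z, hZ⟩, hXZ.ssubset_of_ne hXZ', hZY.ssubset_of_ne hZ'⟩ h2
  · rintro ⟨h1, h2⟩
    refine ⟨h1.ssubset_of_ne fun e => by rw [e] at h2; omega, ?_⟩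
    rintro ⟨Z, h3, h4⟩
    have h5 := hlt X.2 Z.2 h3
    have h6 := hlt Z.2 Y.2 h4
    omega

theorem barycentric_adj (h : IsSWM G) (X Y : BSet G) :
    (barycentric G).Adj X Y ↔ Cov G X.1 Y.1 ∨ Cov G Y.1 X.1 := by
  rw [barycentric, SimpleGraph.fromRel_adj, h.cov_iff, h.cov_iff, and_iff_right_iff_imp]
  rintro (⟨-, h2⟩ | ⟨-, h2⟩) rfl <;> omega

theorem rank_le_farDist (h : IsSWM G) {X U : Set V} (hX : IsBoolean G X) (hU : IsBoolean G U) :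
    rank G X ≤ farDist G X U ∧ rank G U ≤ farDist G X U := by
  constructor
  · obtain ⟨u, hu⟩ := hU.nonempty h
    obtain ⟨g, hg⟩ := hX.exists_gate u
    have := h.gate_add_rank_le hX hU hu hg
    omega
  · obtain ⟨x, hx⟩ := hX.nonempty h
    obtain ⟨g, hg⟩ := hU.exists_gate x
    obtain ⟨y, hy, hd⟩ := h.exists_opposite hU hg.1
    have h1 := hg.2 y hy
    have h2 := h.dist_le_farDist hX hU hx hy
    omega

/-- The formula for the distance in the barycentric graph. -/
theorem barycentric_dist [Nonempty V] (h : IsSWM G) :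
    (barycentric G).Connected ∧ ∀ X U : BSet G,
      (barycentric G).dist X U + rank G X.1 + rank G U.1 = 2 * farDist G X.1 U.1 := by
  have hne : Nonempty (BSet G) := by
    obtain ⟨p⟩ := ‹Nonempty V›
    exact ⟨_, h.isBoolean_hull (h.strict_of_le_one (x := p) (z := p) (by simp))⟩
  obtain ⟨h1, h2⟩ := connected_and_dist_eq (H := barycentric G)
    (f := fun X U => 2 * farDist G X.1 U.1 - rank G X.1 - rank G U.1)
    (fun U => by
      change 2 * rank G U.1 - rank G U.1 - rank G U.1 = 0
      omega)
    (fun U X Y hXY => by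
      have hX := h.rank_le_farDist X.2 U.2
      have hY := h.rank_le_farDist Y.2 U.2
      rcases (h.barycentric_adj X Y).1 hXY with hc | hc
      · have h3 := h.farDist_mono X.2 Y.2 U.2 hc.1
        have h4 := hc.2
        omega
      · have h3 := h.farDist_le_add_one Y.2 X.2 U.2 hc.1 hc.2
        have h4 := hc.2
        omega)
    (fun U X hXU => by
      have hX := h.rank_le_farDist X.2 U.2
      obtain ⟨Y, hY, hc⟩ := h.exists_closer X.2 U.2 fun e => hXU (Subtype.ext e)
      have hY' := h.rank_le_farDist hY U.2
      refine ⟨⟨Y, hY⟩, (h.barycentric_adj X ⟨Y, hY⟩).2 ?_, ?_⟩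
      · exact hc.elim (fun hc => .inr hc.1) fun hc => .inl hc.1
      · dsimp only
        rcases hc with ⟨⟨-, h3⟩, h4⟩ | ⟨⟨-, h3⟩, h4⟩ <;> omega)
  refine ⟨h1, fun X U => ?_⟩
  have := h.rank_le_farDist X.2 U.2
  rw [h2]
  omega

theorem isModularGraph_barycentric [Nonempty V] (h : IsSWM G) :
    IsModularGraph (barycentric G) := by
  obtain ⟨hc, hd⟩ := h.barycentric_dist
  refine isModularGraph_of_quadrangle hc (fun U X Y hXY => ?_)
    fun U Z A B hZA hZB hne hA hB => ?_
  · have h1 := hd X U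
    have h2 := hd Y U
    rcases (h.barycentric_adj X Y).1 hXY with ⟨-, h3⟩ | ⟨-, h3⟩ <;> omega
  · have hdZ := hd Z U
    have hdA := hd A U
    have hdB := hd B U
    have hne' : A.1 ≠ B.1 := fun e => hne (Subtype.ext e)
    have fin : ∀ X, IsBoolean G X → (Cov G A.1 X ∨ Cov G X A.1) → (Cov G B.1 X ∨ Cov G X B.1) →
        (rank G X + 2 * farDist G A.1 U.1 = rank G A.1 + 2 * farDist G X U.1 + 1) →
        ∃ X, (barycentric G).Adj A X ∧ (barycentric G).Adj B X ∧
          (barycentric G).dist X U + 1 = (barycentric G).dist A U := by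
      intro X hX h1 h2 h3
      have hdX := hd ⟨X, hX⟩ U
      exact ⟨⟨X, hX⟩, (h.barycentric_adj _ _).2 h1, (h.barycentric_adj _ _).2 h2, by grind⟩
    rcases (h.barycentric_adj Z A).1 hZA with ca | ca <;>
    rcases (h.barycentric_adj Z B).1 hZB with cb | cb <;>
    have ha := ca.2 <;> have hb := cb.2
    · obtain ⟨X, hX, h1, h2, h3⟩ := h.quad_up U.2 Z.2 A.2 B.2 ca cb hne' (by omega) (by omega)
      have := h1.2
      exact fin X hX (.inl h1) (.inl h2) (by omega)
    · obtain ⟨X, hX, h1, h2, h3⟩ := h.quad_middle U.2 Z.2 B.2 A.2 cb ca (by omega) (by omega)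
      have := h1.2
      have := h2.2
      exact fin X hX (.inr h2) (.inl h1) (by omega)
    · obtain ⟨X, hX, h1, h2, h3⟩ := h.quad_middle U.2 Z.2 A.2 B.2 ca cb (by omega) (by omega)
      have := h1.2
      exact fin X hX (.inl h1) (.inr h2) (by omega)
    · obtain ⟨X, hX, h1, h2, h3⟩ := h.quad_down U.2 Z.2 A.2 B.2 ca cb hne' (by omega) (by omega)
      have := h1.2
      exact fin X hX (.inr h1) (.inr h2) (by omega)

theorem ssubset_of_inducedSquare (h : IsSWM G) {z₁ z₂ z₃ z₄ : BSet G}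
    (hs : InducedSquare (barycentric G) z₁ z₂ z₃ z₄) (h21 : z₂.1 ⊂ z₁.1) : z₃.1 ⊂ z₄.1 := by
  obtain ⟨a12, a23, a34, a41, n13, n24, -, -⟩ := hs
  rw [h.barycentric_adj] at a12 a23 a34 a41
  have r21 := h.rank_mono z₂.2 z₁.2 h21.1
  rcases a34 with c34 | c43
  · refine c34.1.ssubset_of_ne fun e => ?_
    have := c34.2
    rw [e] at this
    omega
  · exfalso
    have e43 := c43.2
    have c21 : Cov G z₂.1 z₁.1 := by
      rcases a12 with c | c
      · have := c.2
        omega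
      · exact c
    have e21 := c21.2
    have hr : Cov G z₂.1 z₃.1 ∧ Cov G z₄.1 z₁.1 := by
      rcases a23 with c | c <;> rcases a41 with c' | c' <;> have := c.2 <;> have := c'.2
      · exact ⟨c, c'⟩
      all_goals omega
    obtain ⟨⟨s23, e23⟩, s41, e41⟩ := hr
    obtain ⟨v, hv⟩ := IsBoolean.nonempty h z₂.2
    have hI : IsBoolean G (z₁.1 ∩ z₃.1) := IsBoolean.subset h z₁.2
      (h.gated_inter (IsBoolean.gated z₁.2) (IsBoolean.gated z₃.2) ⟨v, c21.1 hv, s23 hv⟩)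
      Set.inter_subset_left
    have hlt : rank G (z₁.1 ∩ z₃.1) < rank G z₁.1 := by
      by_contra hge
      have f1 := h.eq_of_rank_le hI z₁.2 Set.inter_subset_left (by omega)
      have f2 := h.eq_of_rank_le hI z₃.2 Set.inter_subset_right (by omega)
      exact n13 (Subtype.ext (f1.symm.trans f2))
    have f2 := h.eq_of_rank_le z₂.2 hI (Set.subset_inter c21.1 s23) (by omega)
    have f4 := h.eq_of_rank_le z₄.2 hI (Set.subset_inter s41 c43.1) (by omega)
    exact n24 (Subtype.ext (f2.trans f4.symm))

theorem barycentric_dist_singleton [Nonempty V] (h : IsSWM G) {p q : V} {X Y : BSet G}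
    (hX : X.1 = {p}) (hY : Y.1 = {q}) : (barycentric G).dist X Y = 2 * G.dist p q := by
  have hd := h.barycentric_dist.2 X Y
  have far : ∀ p q : V, farDist G {p} {q} = G.dist p q := fun p q => by
    simp [farDist]
  rw [hX, hY, far, rank, rank, far, far] at hd
  simpa using hd

end IsSWM

theorem statement2 (G : SimpleGraph V) (hconn : G.Connected) (hwm : WeaklyModular G)
    (h4 : ¬ HasInducedK4minus G) (h33 : ¬ HasIsometricK33minus G) :
    IsModularGraph (barycentric G) ∧
    (∀ z₁ z₂ z₃ z₄ : BSet G, InducedSquare (barycentric G) z₁ z₂ z₃ z₄ →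
      (z₂.1 ⊂ z₁.1 ↔ z₃.1 ⊂ z₄.1)) ∧
    (∀ p q : V, ∀ X Y : BSet G, X.1 = {p} → Y.1 = {q} →
      (barycentric G).dist X Y = 2 * G.dist p q) := by
  have h : IsSWM G := ⟨hconn, hwm, h4, h33⟩
  have := hconn.nonempty
  refine ⟨h.isModularGraph_barycentric, fun z₁ z₂ z₃ z₄ hs => ⟨h.ssubset_of_inducedSquare hs, ?_⟩,
    fun p q X Y hX hY => h.barycentric_dist_singleton hX hY⟩
  obtain ⟨a12, a23, a34, a41, n13, n24, n13', n24'⟩ := hs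
  exact h.ssubset_of_inducedSquare ⟨a34.symm, a23.symm, a12.symm, a41.symm, n24.symm, n13.symm,
    fun e => n24' e.symm, fun e => n13' e.symm⟩
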